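/- Let Ω ⊂ ℝⁿ be a bounded open convex set with diameter d > 0 and let p ≥ 2. For every continuously differentiable function u on a neighborhood of the closure of Ω satisfying ∫_Ω |u(x)|^(p-2) u(x) dx = 0, one has ∫_Ω ‖∇u(x)‖^p dx ≥ (π_p / d)^p ∫_Ω |u(x)|^p dx. -/

import Mathlib

open MeasureTheory

/-- The generalized constant `π_p = 2π (p-1)^(1/p) / (p sin(π/p))`. -/
noncomputable def pi_p (p : ℝ) : ℝ :=
  2 * Real.pi * (p - 1) ^ (1 / p) / (p * Real.sin (Real.pi / p))

section Auxiliary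

open Set Filter Topology

/-- The reciprocal speed of the Riccati flow with drift `μ`, cut off outside `[-B, B]` and where the
speed would fall below `1/2`. -/
noncomputable def riccatiTime (p B μ s : ℝ) : ℝ :=
  (max (1 / 2) (1 + |max (-B) (min s B)| ^ p + μ * max (-B) (min s B)))⁻¹

lemma riccatiTime_pos (p B μ s : ℝ) : 0 < riccatiTime p B μ s :=
  inv_pos.2 (lt_max_of_lt_left (by norm_num))

lemma continuous_riccatiTime {p : ℝ} (hp : 0 ≤ p) (B : ℝ) :
    Continuous (Function.uncurry (riccatiTime p B)) := by
  unfold riccatiTime Function.uncurry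
  refine Continuous.inv₀ ?_ fun x => (lt_max_of_lt_left (by norm_num)).ne'
  have h : Continuous fun x : ℝ × ℝ => max (-B) (min x.2 B) := by fun_prop
  have h2 : Continuous fun x : ℝ × ℝ => |max (-B) (min x.2 B)| ^ p :=
    h.abs.rpow_const fun _ => Or.inr hp
  exact continuous_const.max ((continuous_const.add h2).add (continuous_fst.mul h))

lemma riccatiTime_neg {p B : ℝ} (hB : 0 ≤ B) (μ s : ℝ) :
    riccatiTime p B μ (-s) = riccatiTime p B (-μ) s := by
  have h : max (-B) (min (-s) B) = - max (-B) (min s B) := by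
    simp only [min_def, max_def]
    split_ifs <;> linarith
  unfold riccatiTime
  rw [h, abs_neg, neg_mul, mul_neg]

lemma riccatiTime_bddBelow {p B : ℝ} (hp : 0 ≤ p) (hB : 0 ≤ B) (μ : ℝ) :
    ∃ c > 0, ∀ s, c ≤ riccatiTime p B μ s := by
  refine ⟨(1 + B ^ p + |μ| * B)⁻¹, by positivity, fun s => ?_⟩
  have hc : |max (-B) (min s B)| ≤ B :=
    abs_le.2 ⟨le_max_left _ _, max_le (by linarith) (min_le_right _ _)⟩
  unfold riccatiTime
  refine inv_anti₀ (lt_max_of_lt_left (by norm_num)) (max_le ?_ ?_)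
  · have : 0 ≤ B ^ p := by positivity
    have : 0 ≤ |μ| * B := by positivity
    linarith
  · have h1 : |max (-B) (min s B)| ^ p ≤ B ^ p := Real.rpow_le_rpow (abs_nonneg _) hc hp
    have h2 : μ * max (-B) (min s B) ≤ |μ| * B :=
      (le_abs_self _).trans (by rw [abs_mul]; gcongr)
    linarith

lemma two_div_le_riccatiTime_add {p B s : ℝ} (hs0 : 0 ≤ s) (hs : s ≤ B) (μ : ℝ) :
    2 * (1 / (1 + s ^ p)) ≤ riccatiTime p B μ s + riccatiTime p B (-μ) s := by
  have hc : max (-B) (min s B) = s := by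
    rw [min_eq_left hs, max_eq_right (by linarith)]
  have hk : 0 ≤ s ^ p := by positivity
  unfold riccatiTime
  rw [hc, abs_of_nonneg hs0]
  set K := 1 + s ^ p with hK
  have hK1 : 1 ≤ K := by linarith
  have key : ∀ y : ℝ, 0 ≤ y →
      2 * (1 / K) ≤ (max (1/2) (K + y))⁻¹ + (max (1/2) (K + -y))⁻¹ := by
    intro y hy
    rw [max_eq_right (by linarith : 1/2 ≤ K + y)]
    have hpos : 0 < K + y := by linarith
    rcases le_total (1/2) (K + -y) with h | h
    · rw [max_eq_right h]
      have : 0 < K + -y := by linarith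
      rw [← sub_nonneg]
      have : (K + y)⁻¹ + (K + -y)⁻¹ - 2 * (1 / K) = 2 * y ^ 2 / (K * (K + y) * (K + -y)) := by
        field_simp; ring
      rw [this]; positivity
    · rw [max_eq_left h]
      have h1 : 0 < (K + y)⁻¹ := by positivity
      have h2 : 1 / K ≤ 1 := by rw [div_le_one (by linarith)]; exact hK1
      have : ((1:ℝ)/2)⁻¹ = 2 := by norm_num
      rw [this]; linarith
  rcases le_total 0 (μ * s) with h | h
  · have := key _ h
    rwa [neg_mul]
  · have := key (-(μ * s)) (by linarith)
    rw [neg_neg] at this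
    rw [neg_mul]; linarith

/-- Supersolutions of the Riccati equation with drift `k x₀`, where the zero `x₀` is chosen
so that the solution exists on the whole of `[a, b]`. -/
theorem exists_riccati_supersolution {a b ω B p : ℝ} (hab : a ≤ b) (hω : 0 < ω) (hB : 0 < B)
    (hp : 1 < p) (hlen : ω * (b - a) ≤ 2 * ∫ s in (0:ℝ)..B, 1 / (1 + s ^ p))
    {k : ℝ → ℝ} (hk : ContinuousOn k (Icc a b)) :
    ∃ x₀ ∈ Icc a b, ∃ s s' : ℝ → ℝ, Continuous s ∧ (∀ x, HasDerivAt s (s' x) x) ∧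
      (∀ x ∈ Icc a b, s' x ≤ -(ω * (1 + |s x| ^ p) + k x₀ * s x)) ∧
      (∀ x ≤ x₀, 0 ≤ s x) ∧ (∀ x, x₀ ≤ x → s x ≤ 0) := by
  have hp0 : 0 ≤ p := by linarith
  have hcont := continuous_riccatiTime hp0 B
  have hcontμ : ∀ μ, Continuous (riccatiTime p B μ) := fun μ =>
    hcont.comp (Continuous.prodMk_right μ)
  set R : ℝ → ℝ := fun μ => ∫ s in (0:ℝ)..B, riccatiTime p B μ s with hR
  have hRcont : Continuous R :=
    intervalIntegral.continuous_parametric_intervalIntegral_of_continuous' hcont 0 B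
  have hRpos : ∀ μ, 0 < R μ := fun μ =>
    intervalIntegral.intervalIntegral_pos_of_pos ((hcontμ μ).intervalIntegrable _ _)
      (riccatiTime_pos p B μ) hB
  have hRadd : ∀ μ, ω * (b - a) ≤ R μ + R (-μ) := by
    intro μ
    refine hlen.trans ?_
    rw [hR, ← intervalIntegral.integral_const_mul]
    rw [← intervalIntegral.integral_add ((hcontμ _).intervalIntegrable _ _)
      ((hcontμ _).intervalIntegrable _ _)]
    refine intervalIntegral.integral_mono_on hB.le ?_
      (((hcontμ _).add (hcontμ _)).intervalIntegrable _ _) fun s hs =>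
      two_div_le_riccatiTime_add hs.1 hs.2 μ
    refine ContinuousOn.intervalIntegrable ?_
    rw [uIcc_of_le hB.le]
    refine continuousOn_const.mul (continuousOn_const.div
      (continuousOn_const.add (continuousOn_id.rpow_const fun _ _ => Or.inr hp0)) ?_)
    intro x hx
    have := Real.rpow_nonneg hx.1 p
    positivity
  obtain ⟨x₀, hx₀, h1, h2⟩ : ∃ x₀ ∈ Icc a b, ω * (x₀ - a) ≤ R (k x₀ / ω) ∧
      ω * (b - x₀) ≤ R (-(k x₀ / ω)) := by
    set θ : ℝ → ℝ := fun x => ω * (x - a) - R (k x / ω) with hθ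
    have hθc : ContinuousOn θ (Icc a b) :=
      (by fun_prop : Continuous fun x => ω * (x - a)).continuousOn.sub
        (hRcont.comp_continuousOn (hk.div_const _))
    rcases le_total (θ b) 0 with h | h
    · refine ⟨b, right_mem_Icc.2 hab, by simp only [hθ] at h; linarith, ?_⟩
      rw [sub_self, mul_zero]; exact (hRpos _).le
    · have ha : θ a ≤ 0 := by
        have := hRpos (k a / ω)
        simp only [hθ]; linarith
      obtain ⟨x₀, hx₀, h0⟩ := intermediate_value_Icc hab hθc ⟨ha, h⟩
      refine ⟨x₀, hx₀, by simp only [hθ] at h0; linarith, ?_⟩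
      have := hRadd (k x₀ / ω)
      simp only [hθ] at h0
      nlinarith
  set μ := k x₀ / ω with hμ
  set W := riccatiTime p B μ with hW
  have hWc : Continuous W := hcontμ μ
  set T : ℝ → ℝ := fun s => ∫ r in (0:ℝ)..s, W r with hT
  have hTd : ∀ s, HasDerivAt T (W s) s := fun s =>
    intervalIntegral.integral_hasDerivAt_right (hWc.intervalIntegrable _ _)
      (hWc.stronglyMeasurableAtFilter _ _) hWc.continuousAt
  have hTc : Continuous T := continuous_iff_continuousAt.2 fun s => (hTd s).continuousAt
  have hTm : StrictMono T := strictMono_of_deriv_pos fun s => by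
    rw [(hTd s).deriv]; exact riccatiTime_pos _ _ _ _
  have hT0 : T 0 = 0 := by simp [hT]
  obtain ⟨c, hc, hcW⟩ := riccatiTime_bddBelow hp0 hB.le μ
  have hTsurj : Function.Surjective T := by
    have hge : ∀ s, 0 ≤ s → c * s ≤ T s := by
      intro s hs
      have := intervalIntegral.integral_mono_on hs (by simp : IntervalIntegrable (fun _ => c)
        volume 0 s) (hWc.intervalIntegrable _ _) fun x _ => hcW x
      simpa [mul_comm] using this
    have hle : ∀ s, s ≤ 0 → T s ≤ c * s := by
      intro s hs
      have := intervalIntegral.integral_mono_on hs (by simp : IntervalIntegrable (fun _ => c)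
        volume s 0) (hWc.intervalIntegrable _ _) fun x _ => hcW x
      simp only [intervalIntegral.integral_const, smul_eq_mul] at this
      rw [intervalIntegral.integral_symm 0 s] at this
      simp only [hT, hW] at this ⊢
      linarith
    refine hTc.surjective ?_ ?_
    · exact tendsto_atTop_mono' _ ((eventually_ge_atTop 0).mono hge)
        (tendsto_id.const_mul_atTop hc)
    · exact tendsto_atBot_mono' _ ((eventually_le_atBot 0).mono hle)
        (tendsto_id.const_mul_atBot hc)
  set e := hTm.orderIsoOfSurjective T hTsurj with he
  have heT : ∀ s, e s = T s := fun s => rfl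
  have hTe : ∀ y, T (e.symm y) = y := fun y => e.apply_symm_apply y
  have hed : ∀ y, HasDerivAt e.symm (W (e.symm y))⁻¹ y := fun y =>
    HasDerivAt.of_local_left_inverse e.symm.continuous.continuousAt (hTd _)
      (riccatiTime_pos _ _ _ _).ne' (Eventually.of_forall hTe)
  have hTB : T B = R μ := rfl
  have hTnB : T (-B) = -R (-μ) := by
    simp only [hT, hR]
    rw [intervalIntegral.integral_symm]
    congr 1
    have := intervalIntegral.integral_comp_neg (a := 0) (b := B) (fun s => W s)
    rw [neg_zero] at this
    rw [← this]
    exact intervalIntegral.integral_congr fun s _ => riccatiTime_neg hB.le μ s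
  have hmono : ∀ s y, s ≤ e.symm y ↔ T s ≤ y := fun s y => by
    rw [OrderIso.le_symm_apply]; rfl
  have hmono' : ∀ s y, e.symm y ≤ s ↔ y ≤ T s := fun s y => by
    rw [OrderIso.symm_apply_le]; rfl
  refine ⟨x₀, hx₀, fun x => e.symm (ω * (x₀ - x)),
    fun x => (W (e.symm (ω * (x₀ - x))))⁻¹ * (-ω), ?_, ?_, ?_, ?_, ?_⟩
  · exact e.symm.continuous.comp (by fun_prop)
  · intro x
    have h : HasDerivAt (fun x => ω * (x₀ - x)) (-ω) x := by
      simpa using ((hasDerivAt_id x).const_sub x₀).const_mul ω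
    exact (hed _).comp x h
  · intro x hx
    have hb1 : e.symm (ω * (x₀ - x)) ≤ B := by
      rw [hmono', hTB]; refine le_trans ?_ h1; nlinarith [hx.1]
    have hb2 : -B ≤ e.symm (ω * (x₀ - x)) := by
      rw [hmono, hTnB]; nlinarith [hx.2]
    beta_reduce
    generalize e.symm (ω * (x₀ - x)) = s at hb1 hb2 ⊢
    simp only [hW, riccatiTime, inv_inv, min_eq_left hb1, max_eq_right hb2]
    have := le_max_right (1/2) (1 + |s| ^ p + μ * s)
    have h3 : k x₀ * s = ω * (μ * s) := by rw [hμ]; field_simp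
    rw [h3]
    nlinarith
  · intro x hx
    rw [hmono, hT0]; nlinarith
  · intro x hx
    rw [hmono', hT0]; nlinarith

/-- A sharp one-dimensional weighted Dirichlet inequality for log-convex weights `exp h`. -/
theorem integral_exp_mul_abs_rpow_le {a b ω B p q : ℝ} (hab : a ≤ b) (hω : 0 < ω) (hB : 0 < B)
    (hpq : p.HolderConjugate q) (hlen : ω * (b - a) ≤ 2 * ∫ s in (0:ℝ)..B, 1 / (1 + s ^ p))
    {h k F g : ℝ → ℝ} (hh : ContinuousOn h (Icc a b)) (hk : ContinuousOn k (Icc a b))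
    (hhk : ∀ x ∈ Ioo a b, HasDerivAt h (k x) x) (hmono : MonotoneOn k (Icc a b))
    (hF : ContinuousOn F (Icc a b)) (hFa : F a = 0) (hFb : F b = 0)
    (hFg : ∀ x ∈ Ioo a b, HasDerivAt F (g x) x)
    (hg : IntegrableOn (fun x => Real.exp (h x) * |g x| ^ q) (Icc a b)) :
    ω ^ q * (q - 1) ^ (1 - q) * ∫ x in a..b, Real.exp (h x) * |F x| ^ q ≤
      ∫ x in a..b, Real.exp (h x) * |g x| ^ q := by
  have hp := hpq.lt
  have hq := hpq.symm.lt
  obtain ⟨x₀, hx₀, s, s', hsc, hsd, hss, hsl, hsr⟩ :=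
    exists_riccati_supersolution hab hω hB hp hlen hk
  set c := q - 1 with hc
  have hc0 : 0 < c := by linarith
  set κ := (ω / c) ^ (q - 1) with hκ
  set lam := ω ^ q * c ^ (1 - q) with hlam
  have hκ0 : 0 < κ := by positivity
  have hlam1 : lam = κ * ω := by
    rw [hlam, hκ, Real.div_rpow hω.le hc0.le, Real.rpow_sub_one hω.ne', ← hc,
      show 1 - q = -c by ring, Real.rpow_neg hc0.le]
    field_simp
  have hlam2 : lam = c * κ ^ p := by
    rw [hlam1, hκ, ← Real.rpow_mul (by positivity)]
    have : (q - 1) * p = (q - 1) + 1 := by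
      have := hpq.symm.sub_one_mul_conj; linarith
    rw [this, Real.rpow_add (by positivity), Real.rpow_one]
    field_simp
  have hFq : ContinuousOn (fun x => |F x| ^ q) (Icc a b) :=
    hF.abs.rpow_const fun _ _ => Or.inr (by linarith)
  have hexp : ContinuousOn (fun x => Real.exp (h x)) (Icc a b) := hh.rexp
  have hint1 : IntegrableOn (fun x => Real.exp (h x) * |F x| ^ q) (Icc a b) :=
    (hexp.mul hFq).integrableOn_Icc
  have key := intervalIntegral.sub_le_integral_of_hasDeriv_right_of_le
    (g := fun x => Real.exp (h x) * |F x| ^ q * (κ * s x))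
    (g' := fun x => (Real.exp (h x) * k x * |F x| ^ q +
      Real.exp (h x) * (q * |F x| ^ (q - 2) * F x * g x)) * (κ * s x) +
      Real.exp (h x) * |F x| ^ q * (κ * s' x))
    (φ := fun x => Real.exp (h x) * |g x| ^ q - lam * (Real.exp (h x) * |F x| ^ q))
    hab ((hexp.mul hFq).mul (continuous_const.mul hsc).continuousOn) ?_
    (hg.sub (hint1.const_mul lam)) ?_
  · simp only [hFa, hFb, abs_zero, Real.zero_rpow (by linarith : q ≠ 0), mul_zero, zero_mul,
      sub_zero] at key
    rw [intervalIntegral.integral_sub, intervalIntegral.integral_const_mul] at key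
    · linarith
    · rw [intervalIntegrable_iff_integrableOn_Icc_of_le hab]; exact hg
    · rw [intervalIntegrable_iff_integrableOn_Icc_of_le hab]; exact hint1.const_mul lam
  · intro x hx
    exact (((hhk x hx).exp.mul ((hasDerivAt_abs_rpow (F x) hq).comp x (hFg x hx))).mul
      ((hsd x).const_mul κ)).hasDerivWithinAt
  · intro x hx
    have hxI : x ∈ Icc a b := Ioo_subset_Icc_self hx
    have hs1 := hss x hxI
    have hks : (k x - k x₀) * s x ≤ 0 := by
      rcases le_total x x₀ with hle | hle
      · exact mul_nonpos_of_nonpos_of_nonneg (sub_nonpos.2 (hmono hxI hx₀ hle)) (hsl x hle)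
      · exact mul_nonpos_of_nonneg_of_nonpos (sub_nonneg.2 (hmono hx₀ hxI hle)) (hsr x hle)
    have hv : κ * s' x + k x * (κ * s x) ≤ -(lam + c * (κ * |s x|) ^ p) := by
      rw [Real.mul_rpow hκ0.le (abs_nonneg _), ← mul_assoc c, ← hlam2, hlam1]
      nlinarith
    have hY : q * |F x| ^ (q - 2) * F x * g x * (κ * s x) ≤
        |g x| ^ q + c * (|F x| ^ q * (κ * |s x|) ^ p) := by
      have h1 : q * |F x| ^ (q - 2) * F x * g x * (κ * s x) ≤
          q * (|g x| * (|F x| ^ (q - 1) * (κ * |s x|))) := by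
        refine (le_abs_self _).trans (le_of_eq ?_)
        rw [abs_mul, abs_mul, abs_mul, abs_mul, abs_mul, abs_of_pos (by linarith : 0 < q),
          abs_of_pos hκ0, abs_of_nonneg (by positivity : 0 ≤ |F x| ^ (q - 2))]
        rcases eq_or_ne (F x) 0 with h0 | h0
        · simp [h0, Real.zero_rpow (show q - 1 ≠ 0 from hc0.ne')]
        · rw [show q - 1 = (q - 2) + 1 by ring, Real.rpow_add_one (abs_pos.2 h0).ne']
          ring
      have h2 := Real.young_inequality_of_nonneg (abs_nonneg (g x))
        (by positivity : 0 ≤ |F x| ^ (q - 1) * (κ * |s x|)) hpq.symm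
      rw [Real.mul_rpow (by positivity) (by positivity), ← Real.rpow_mul (abs_nonneg _),
        hpq.symm.sub_one_mul_conj] at h2
      have h3 : q / p = c := by
        rw [hc, ← hpq.symm.div_conj_eq_sub_one]
      calc _ ≤ _ := h1
        _ ≤ q * (|g x| ^ q / q + |F x| ^ q * (κ * |s x|) ^ p / p) := by gcongr
        _ = |g x| ^ q + (q / p) * (|F x| ^ q * (κ * |s x|) ^ p) := by
            field_simp
        _ = _ := by rw [h3]
    have hE := Real.exp_pos (h x)
    have hFq0 : 0 ≤ |F x| ^ q := by positivity
    have : (k x * |F x| ^ q + q * |F x| ^ (q - 2) * F x * g x) * (κ * s x) +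
        |F x| ^ q * (κ * s' x) ≤ |g x| ^ q - lam * |F x| ^ q := by
      nlinarith
    calc _ = Real.exp (h x) * ((k x * |F x| ^ q + q * |F x| ^ (q - 2) * F x * g x) * (κ * s x) +
        |F x| ^ q * (κ * s' x)) := by ring
      _ ≤ Real.exp (h x) * (|g x| ^ q - lam * |F x| ^ q) := by gcongr
      _ = _ := by ring

lemma beta_one_div_one_sub_one_div {p : ℝ} :
    ProbabilityTheory.beta (1 / p) (1 - 1 / p) = Real.pi / Real.sin (Real.pi / p) := by
  rw [ProbabilityTheory.beta, Real.Gamma_mul_Gamma_one_sub, add_sub_cancel, Real.Gamma_one,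
    div_one, mul_one_div]

lemma image_rpow_div_one_add_rpow {p : ℝ} (hp : 0 < p) :
    (fun s : ℝ => 1 - (1 + s ^ p)⁻¹) '' Ioi 0 = Ioo 0 1 := by
  ext x
  constructor
  · rintro ⟨s, hs, rfl⟩
    have h : 0 < s ^ p := Real.rpow_pos_of_pos hs p
    have h1 : (1 + s ^ p)⁻¹ < 1 := inv_lt_one_of_one_lt₀ (by linarith)
    have h2 : 0 < (1 + s ^ p)⁻¹ := by positivity
    constructor <;> simp only <;> linarith
  · rintro ⟨h0, h1⟩
    have h : 0 < x / (1 - x) := div_pos h0 (by linarith)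
    refine ⟨(x / (1 - x)) ^ p⁻¹, Real.rpow_pos_of_pos h _, ?_⟩
    have h2 : 1 - x ≠ 0 := by linarith
    simp only
    rw [← Real.rpow_mul h.le, inv_mul_cancel₀ hp.ne', Real.rpow_one]
    field_simp
    ring

lemma lintegral_inv_one_add_rpow {p : ℝ} (hp : 1 < p) :
    ∫⁻ s in Ioi (0:ℝ), ENNReal.ofReal (p / (Real.pi / Real.sin (Real.pi / p)) * (1 / (1 + s ^ p)))
      = 1 := by
  have hp0 : 0 < p := by linarith
  have hα : 0 < 1 / p := by positivity
  have hβ : 0 < 1 - 1 / p := by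
    rw [sub_pos, div_lt_one hp0]; exact hp
  have h1 := ProbabilityTheory.lintegral_betaPDF_eq_one hα hβ
  rw [ProbabilityTheory.lintegral_betaPDF, ← image_rpow_div_one_add_rpow hp0,
    lintegral_image_eq_lintegral_abs_deriv_mul (f' := fun s => p * s ^ (p - 1) / (1 + s ^ p) ^ 2)
      measurableSet_Ioi, beta_one_div_one_sub_one_div] at h1
  · rw [← h1]
    refine setLIntegral_congr_fun measurableSet_Ioi fun s hs => ?_
    have hs0 : (0:ℝ) < s := hs
    have hK : 0 < 1 + s ^ p := by positivity
    rw [← ENNReal.ofReal_mul (abs_nonneg _), abs_of_pos (by positivity)]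
    congr 1
    have e1 : 1 - (1 + s ^ p)⁻¹ = s ^ p / (1 + s ^ p) := by field_simp; ring
    have e2 : 1 - s ^ p / (1 + s ^ p) = (1 + s ^ p)⁻¹ := by field_simp; ring
    rw [e1, e2, Real.div_rpow (by positivity) hK.le, Real.inv_rpow hK.le,
      ← Real.rpow_mul hs0.le, show p * (1 / p - 1) = -(p - 1) by field_simp; ring,
      Real.rpow_neg hs0.le, show 1 - 1 / p - 1 = -(1 / p) by ring, Real.rpow_neg hK.le,
      Real.rpow_sub_one hK.ne']
    have := Real.rpow_pos_of_pos hs0 (p - 1)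
    have := Real.rpow_pos_of_pos hK (1 / p)
    field_simp
  · intro s hs
    have hs0 : (0:ℝ) < s := hs
    have hK : 0 < 1 + s ^ p := by positivity
    have := (((Real.hasDerivAt_rpow_const (p := p) (Or.inl hs0.ne')).const_add 1).inv
      hK.ne').const_sub 1
    rw [neg_div, neg_neg] at this
    exact this.hasDerivWithinAt
  · intro s hs t ht hst
    have hs0 : (0:ℝ) < s := hs
    have ht0 : (0:ℝ) < t := ht
    have : s ^ p = t ^ p := by
      simp only [sub_right_inj, inv_inj, add_right_inj] at hst
      exact hst
    exact (Real.rpow_left_inj hs0.le ht0.le hp0.ne').1 this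

/-- Truncations of `∫₀^∞ ds / (1 + s ^ p)` approach `π / (p sin (π / p))`. -/
lemma exists_le_integral_inv_one_add_rpow {p y : ℝ} (hp : 1 < p)
    (hy : y < Real.pi / (p * Real.sin (Real.pi / p))) :
    ∃ B > 0, y ≤ ∫ s in (0:ℝ)..B, 1 / (1 + s ^ p) := by
  have hp0 : 0 < p := by linarith
  have hsin : 0 < Real.sin (Real.pi / p) :=
    Real.sin_pos_of_pos_of_lt_pi (by positivity) (div_lt_self Real.pi_pos hp)
  have hβ : 0 < Real.pi / Real.sin (Real.pi / p) := div_pos Real.pi_pos hsin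
  set β := Real.pi / Real.sin (Real.pi / p) with hβd
  have h1 := lintegral_inv_one_add_rpow hp
  rw [← hβd] at h1
  have hmeas : Measurable fun s : ℝ => p / β * (1 / (1 + s ^ p)) := by fun_prop
  have hnn : ∀ᵐ s ∂(volume.restrict (Ioi (0:ℝ))), 0 ≤ p / β * (1 / (1 + s ^ p)) := by
    filter_upwards [ae_restrict_mem measurableSet_Ioi] with s hs
    have : (0:ℝ) < s := hs
    positivity
  have hint : IntegrableOn (fun s : ℝ => p / β * (1 / (1 + s ^ p))) (Ioi 0) := by
    refine ⟨hmeas.aestronglyMeasurable, ?_⟩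
    rw [hasFiniteIntegral_iff_ofReal hnn, h1]
    exact ENNReal.one_lt_top
  have hval : ∫ s in Ioi (0:ℝ), p / β * (1 / (1 + s ^ p)) = 1 := by
    rw [integral_eq_lintegral_of_nonneg_ae hnn hmeas.aestronglyMeasurable, h1]
    rfl
  have ht := intervalIntegral_tendsto_integral_Ioi 0 hint tendsto_id
  rw [hval] at ht
  have hlt : p / β * y < 1 := by
    have : Real.pi / (p * Real.sin (Real.pi / p)) = β / p := by
      rw [hβd, div_div, mul_comm]
    rw [this, lt_div_iff₀ hp0] at hy
    rw [div_mul_eq_mul_div, div_lt_one hβ]; linarith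
  obtain ⟨B, hB1, hB2⟩ := ((ht.eventually (eventually_gt_nhds hlt)).and
    (eventually_gt_atTop 0)).exists
  refine ⟨B, hB2, ?_⟩
  simp only [id, intervalIntegral.integral_const_mul] at hB1
  have : 0 < p / β := by positivity
  exact (lt_of_mul_lt_mul_left hB1 this.le).le

section PrekopaLeindler

open scoped ENNReal Pointwise

lemma volume_add_le_of_isCompact {A B C : Set ℝ} (hA : IsCompact A) (hB : IsCompact B)
    (hA0 : A.Nonempty) (hB0 : B.Nonempty) (hC : ∀ x ∈ A, ∀ y ∈ B, x + y ∈ C) :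
    volume A + volume B ≤ volume C := by
  obtain ⟨x, hxA, hx⟩ := hA.exists_isGreatest hA0
  obtain ⟨y, hyB, hy⟩ := hB.exists_isLeast hB0
  have h1 : volume ((fun z => z + y) '' A) = volume A := by
    rw [image_add_right, measure_preimage_add_right]
  have h2 : volume ((fun z => x + z) '' B) = volume B := by
    rw [image_add_left, measure_preimage_add]
  have h3 : MeasurableSet ((fun z => x + z) '' B) :=
    (hB.image (by fun_prop)).measurableSet
  rw [← h1, ← h2, ← measure_union_add_inter _ h3]
  have h4 : volume ((fun z => z + y) '' A ∩ (fun z => x + z) '' B) = 0 := by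
    refine measure_mono_null (t := {x + y}) ?_ (measure_singleton _)
    rintro _ ⟨⟨a, ha, rfl⟩, ⟨b, hb, hab⟩⟩
    have := hx ha
    have := hy hb
    simp only [mem_singleton_iff] at hab ⊢
    linarith
  rw [h4, add_zero]
  refine measure_mono (union_subset ?_ ?_)
  · rintro _ ⟨a, ha, rfl⟩; exact hC _ ha _ hyB
  · rintro _ ⟨b, hb, rfl⟩; exact hC _ hxA _ hb

lemma volume_le_iSup_isCompact_nonempty {A : Set ℝ} (hA : MeasurableSet A) (hA0 : A.Nonempty) :
    volume A ≤ ⨆ K : {K : Set ℝ // K ⊆ A ∧ IsCompact K ∧ K.Nonempty}, volume K.1 := by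
  obtain ⟨x, hx⟩ := hA0
  rw [hA.measure_eq_iSup_isCompact]
  refine iSup_le fun K => iSup_le fun hKA => iSup_le fun hK => ?_
  rcases K.eq_empty_or_nonempty with rfl | hK0
  · simp
  · exact le_iSup (fun K : {K : Set ℝ // K ⊆ A ∧ IsCompact K ∧ K.Nonempty} => volume K.1)
      ⟨K, hKA, hK, hK0⟩

/-- The one-dimensional Brunn–Minkowski inequality. -/
lemma volume_add_le_of_measurableSet {A B C : Set ℝ} (hA : MeasurableSet A) (hB : MeasurableSet B)
    (hA0 : A.Nonempty) (hB0 : B.Nonempty) (hC : ∀ x ∈ A, ∀ y ∈ B, x + y ∈ C) :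
    volume A + volume B ≤ volume C := by
  have hne : ∀ {A : Set ℝ}, A.Nonempty →
      Nonempty {K : Set ℝ // K ⊆ A ∧ IsCompact K ∧ K.Nonempty} := fun ⟨x, hx⟩ =>
    ⟨⟨{x}, singleton_subset_iff.2 hx, isCompact_singleton, singleton_nonempty x⟩⟩
  have := hne hA0
  have := hne hB0
  refine (add_le_add (volume_le_iSup_isCompact_nonempty hA hA0)
    (volume_le_iSup_isCompact_nonempty hB hB0)).trans (ENNReal.iSup_add_iSup_le fun K L => ?_)
  exact volume_add_le_of_isCompact K.2.2.1 L.2.2.1 K.2.2.2 L.2.2.2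
    fun x hx y hy => hC x (K.2.1 hx) y (L.2.1 hy)

/-- The Prékopa–Leindler inequality, as a property of a measured vector space. -/
def PrekopaLeindler (E : Type*) [AddCommGroup E] [Module ℝ E] [MeasureSpace E] : Prop :=
  ∀ l : ℝ, 0 < l → l < 1 → ∀ f g h : E → ℝ≥0∞, Measurable f → Measurable g → Measurable h →
    (∀ x y, f x ^ (1 - l) * g y ^ l ≤ h ((1 - l) • x + l • y)) →
    (∫⁻ x, f x) ^ (1 - l) * (∫⁻ x, g x) ^ l ≤ ∫⁻ x, h x

lemma ENNReal.rpow_mul_rpow_le_add {l : ℝ} (hl0 : 0 < l) (hl1 : l < 1) (a b : ℝ≥0∞) :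
    a ^ (1 - l) * b ^ l ≤ ENNReal.ofReal (1 - l) * a + ENNReal.ofReal l * b := by
  have h1 : 0 < 1 - l := by linarith
  rcases eq_or_ne a ⊤ with rfl | ha
  · rw [ENNReal.mul_top (by simpa using hl1)]; simp
  rcases eq_or_ne b ⊤ with rfl | hb
  · rw [ENNReal.mul_top (by simpa using hl0)]; simp
  lift a to NNReal using ha
  lift b to NNReal using hb
  have := NNReal.geom_mean_le_arith_mean2_weighted (1 - l).toNNReal l.toNNReal a b
    (by rw [← Real.toNNReal_add h1.le hl0.le]; simp)
  rw [Real.coe_toNNReal _ h1.le, Real.coe_toNNReal _ hl0.le] at this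
  rw [← ENNReal.coe_rpow_of_nonneg _ h1.le, ← ENNReal.coe_rpow_of_nonneg _ hl0.le,
    ENNReal.ofReal, ENNReal.ofReal]
  exact_mod_cast this

lemma lintegral_add_le_of_normalized {l : ℝ} (hl0 : 0 < l) (hl1 : l < 1) {f g h : ℝ → ℝ}
    (hf : Measurable f) (hg : Measurable g) (hh : Measurable h) (hf0 : ∀ x, 0 ≤ f x)
    (hg0 : ∀ x, 0 ≤ g x) (hh0 : ∀ x, 0 ≤ h x) (hf1 : ∀ x, f x ≤ 1) (hg1 : ∀ x, g x ≤ 1)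
    (hfs : ∀ t < 1, ∃ x, t < f x) (hgs : ∀ t < 1, ∃ x, t < g x)
    (hfg : ∀ x y, f x ^ (1 - l) * g y ^ l ≤ h ((1 - l) * x + l * y)) :
    ENNReal.ofReal (1 - l) * (∫⁻ x, ENNReal.ofReal (f x)) +
      ENNReal.ofReal l * (∫⁻ x, ENNReal.ofReal (g x)) ≤ ∫⁻ x, ENNReal.ofReal (h x) := by
  have h1 : 0 < 1 - l := by linarith
  have hmeas : ∀ f : ℝ → ℝ, Measurable fun t => volume {a | t < f a} := fun f =>
    Antitone.measurable fun s t hst => measure_mono fun a (ha : t < f a) => hst.trans_lt ha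
  rw [lintegral_eq_lintegral_meas_lt _ (.of_forall hf0) hf.aemeasurable,
    lintegral_eq_lintegral_meas_lt _ (.of_forall hg0) hg.aemeasurable,
    lintegral_eq_lintegral_meas_lt _ (.of_forall hh0) hh.aemeasurable,
    ← lintegral_const_mul _ (hmeas f), ← lintegral_const_mul _ (hmeas g),
    ← lintegral_add_left ((hmeas f).const_mul _)]
  refine setLIntegral_mono (hmeas h) fun t (ht : 0 < t) => ?_
  rcases lt_or_ge t 1 with ht1 | ht1
  · have key := volume_add_le_of_measurableSet (A := (1 - l) • {a | t < f a})
      (B := l • {a | t < g a}) (C := {a | t < h a})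
      ((measurableSet_lt measurable_const hf).const_smul₀ _)
      ((measurableSet_lt measurable_const hg).const_smul₀ _)
      (Set.Nonempty.smul_set (hfs t ht1)) (Set.Nonempty.smul_set (hgs t ht1)) ?_
    · rw [Measure.addHaar_smul, Measure.addHaar_smul] at key
      simpa [abs_of_pos h1, abs_of_pos hl0] using key
    · rintro _ ⟨x, hx, rfl⟩ _ ⟨y, hy, rfl⟩
      have hx' : t < f x := hx
      have hy' : t < g y := hy
      refine lt_of_lt_of_le ?_ (hfg x y)
      calc t = t ^ (1 - l) * t ^ l := by
            rw [← Real.rpow_add ht, sub_add_cancel, Real.rpow_one]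
        _ < f x ^ (1 - l) * g y ^ l := by
            apply mul_lt_mul'' (Real.rpow_lt_rpow ht.le hx' h1) (Real.rpow_lt_rpow ht.le hy' hl0)
              <;> positivity
  · have e1 : {a | t < f a} = ∅ := by
      ext a; simpa using (hf1 a).trans ht1
    have e2 : {a | t < g a} = ∅ := by
      ext a; simpa using (hg1 a).trans ht1
    simp [e1, e2]

lemma rpow_lintegral_mul_le_of_bounded {l : ℝ} (hl0 : 0 < l) (hl1 : l < 1) {f g h : ℝ → ℝ≥0∞}
    (hf : Measurable f) (hg : Measurable g) (hh : Measurable h) {M : ℝ≥0∞} (hM : M ≠ ⊤)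
    (hfM : ∀ x, f x ≤ M) (hgM : ∀ x, g x ≤ M)
    (hfg : ∀ x y, f x ^ (1 - l) * g y ^ l ≤ h ((1 - l) • x + l • y)) :
    (∫⁻ x, f x) ^ (1 - l) * (∫⁻ x, g x) ^ l ≤ ∫⁻ x, h x := by
  have h1 : 0 < 1 - l := by linarith
  set P := ⨆ x, f x with hP
  set Q := ⨆ x, g x with hQ
  have hPt : P ≠ ⊤ := ne_top_of_le_ne_top hM (iSup_le hfM)
  have hQt : Q ≠ ⊤ := ne_top_of_le_ne_top hM (iSup_le hgM)
  have hfP : ∀ x, f x ≤ P := le_iSup f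
  have hgQ : ∀ x, g x ≤ Q := le_iSup g
  rcases eq_or_ne P 0 with hP0 | hP0
  · have : ∀ x, f x = 0 := fun x => le_antisymm ((hfP x).trans hP0.le) bot_le
    simp [this, ENNReal.zero_rpow_of_pos h1]
  rcases eq_or_ne Q 0 with hQ0 | hQ0
  · have : ∀ x, g x = 0 := fun x => le_antisymm ((hgQ x).trans hQ0.le) bot_le
    simp [this, ENNReal.zero_rpow_of_pos hl0]
  set N := P ^ (1 - l) * Q ^ l with hN
  have hPr0 : P ^ (1 - l) ≠ 0 := by
    simp [ENNReal.rpow_eq_zero_iff, hP0, hPt]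
  have hQr0 : Q ^ l ≠ 0 := by
    simp [ENNReal.rpow_eq_zero_iff, hQ0, hQt]
  have hPrt : P ^ (1 - l) ≠ ⊤ := ENNReal.rpow_ne_top_of_nonneg h1.le hPt
  have hQrt : Q ^ l ≠ ⊤ := ENNReal.rpow_ne_top_of_nonneg hl0.le hQt
  have hN0 : N ≠ 0 := mul_ne_zero hPr0 hQr0
  have hNt : N ≠ ⊤ := ENNReal.mul_ne_top hPrt hQrt
  have hle1 : ∀ {a b : ℝ≥0∞}, a ≤ b → a / b ≤ 1 := fun h => ENNReal.div_le_of_le_mul (by simpa)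
  have hfin : ∀ {a b : ℝ≥0∞}, a ≤ b → a / b ≠ ⊤ := fun h =>
    ne_top_of_le_ne_top ENNReal.one_ne_top (hle1 h)
  have hsup : ∀ {F : ℝ → ℝ≥0∞} {S : ℝ≥0∞}, S = ⨆ x, F x → S ≠ 0 → S ≠ ⊤ → ∀ t < (1:ℝ),
      ∃ x, t < (F x / S).toReal := by
    intro F S hS hS0 hSt t ht
    rcases lt_or_ge t 0 with ht0 | ht0
    · exact ⟨0, ht0.trans_le ENNReal.toReal_nonneg⟩
    have hlt : ENNReal.ofReal t * S < ⨆ x, F x := by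
      rw [← hS]
      calc ENNReal.ofReal t * S < 1 * S := by
            rw [ENNReal.mul_lt_mul_iff_left hS0 hSt]
            exact ENNReal.ofReal_lt_one.2 ht
        _ = S := one_mul S
    obtain ⟨x, hx⟩ := lt_iSup_iff.1 hlt
    refine ⟨x, ?_⟩
    have hx2 : F x ≤ S := hS ▸ le_iSup F x
    rw [← ENNReal.ofReal_lt_iff_lt_toReal ht0 (hfin hx2), ENNReal.lt_div_iff_mul_lt
      (Or.inl hS0) (Or.inl hSt)]
    exact hx
  have hhfin : ∀ x, min (h x / N) 1 ≠ ⊤ := fun x =>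
    ne_top_of_le_ne_top ENNReal.one_ne_top (min_le_right _ _)
  have key := lintegral_add_le_of_normalized hl0 hl1 (f := fun x => (f x / P).toReal)
    (g := fun x => (g x / Q).toReal) (h := fun x => (min (h x / N) 1).toReal)
    (hf.div_const _).ennreal_toReal (hg.div_const _).ennreal_toReal
    ((hh.div_const _).min measurable_const).ennreal_toReal (fun _ => ENNReal.toReal_nonneg)
    (fun _ => ENNReal.toReal_nonneg) (fun _ => ENNReal.toReal_nonneg)
    (fun x => ENNReal.toReal_le_of_le_ofReal zero_le_one (by simpa using hle1 (hfP x)))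
    (fun x => ENNReal.toReal_le_of_le_ofReal zero_le_one (by simpa using hle1 (hgQ x)))
    (hsup hP hP0 hPt) (hsup hQ hQ0 hQt) ?_
  · simp only [ENNReal.ofReal_toReal (hfin (hfP _)), ENNReal.ofReal_toReal (hfin (hgQ _)),
      ENNReal.ofReal_toReal (hhfin _)] at key
    have key2 : (∫⁻ x, f x / P) ^ (1 - l) * (∫⁻ x, g x / Q) ^ l ≤ ∫⁻ x, h x / N :=
      (ENNReal.rpow_mul_rpow_le_add hl0 hl1 _ _).trans
        (key.trans (lintegral_mono fun x => min_le_left _ _))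
    simp only [div_eq_mul_inv] at key2
    rw [lintegral_mul_const _ hf, lintegral_mul_const _ hg, lintegral_mul_const _ hh,
      ENNReal.mul_rpow_of_nonneg _ _ h1.le, ENNReal.mul_rpow_of_nonneg _ _ hl0.le,
      ENNReal.inv_rpow, ENNReal.inv_rpow, mul_mul_mul_comm,
      ← ENNReal.mul_inv (Or.inl hPr0) (Or.inl hPrt), ← hN] at key2
    exact (ENNReal.mul_le_mul_iff_left (ENNReal.inv_ne_zero.2 hNt)
      (ENNReal.inv_ne_top.2 hN0)).1 key2
  · intro x y
    rw [ENNReal.toReal_rpow, ENNReal.toReal_rpow, ← ENNReal.toReal_mul]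
    refine ENNReal.toReal_mono (hhfin _) (le_min ?_ ?_)
    · rw [ENNReal.div_rpow_of_nonneg _ _ h1.le, ENNReal.div_rpow_of_nonneg _ _ hl0.le,
        div_eq_mul_inv, div_eq_mul_inv, mul_mul_mul_comm,
        ← ENNReal.mul_inv (Or.inl hPr0) (Or.inl hPrt), ← hN, ← div_eq_mul_inv]
      exact ENNReal.div_le_div_right (hfg x y) _
    · exact mul_le_one' (ENNReal.rpow_le_one (hle1 (hfP x)) h1.le)
        (ENNReal.rpow_le_one (hle1 (hgQ y)) hl0.le)

lemma lintegral_eq_iSup_min_natCast {α : Type*} [MeasurableSpace α] (μ : Measure α)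
    {f : α → ℝ≥0∞} (hf : Measurable f) :
    ∫⁻ x, f x ∂μ = ⨆ n : ℕ, ∫⁻ x, min (f x) n ∂μ := by
  rw [← lintegral_iSup (fun n => hf.min measurable_const)
    (fun m n hmn x => min_le_min_left _ (by exact_mod_cast hmn))]
  refine lintegral_congr fun x => ?_
  refine le_antisymm ?_ (iSup_le fun n => min_le_left _ _)
  refine le_of_forall_lt fun c hc => ?_
  obtain ⟨n, hn⟩ := ENNReal.exists_nat_gt (ne_top_of_lt hc)
  exact lt_iSup_iff.2 ⟨n, lt_min hc hn⟩

theorem prekopaLeindler_real : PrekopaLeindler ℝ := by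
  intro l hl0 hl1 f g h hf hg hh hfg
  have h1 : 0 < 1 - l := by linarith
  have hmono : ∀ f : ℝ → ℝ≥0∞, Monotone fun n : ℕ => ∫⁻ x, min (f x) n := fun f m n hmn =>
    lintegral_mono fun x => min_le_min_left _ (by exact_mod_cast hmn)
  rw [lintegral_eq_iSup_min_natCast volume hf, lintegral_eq_iSup_min_natCast volume hg,
    (ENNReal.monotone_rpow_of_nonneg h1.le).map_iSup_of_continuousAt
      (ENNReal.continuous_rpow_const.continuousAt) (by simp [ENNReal.zero_rpow_of_pos h1]),
    (ENNReal.monotone_rpow_of_nonneg hl0.le).map_iSup_of_continuousAt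
      (ENNReal.continuous_rpow_const.continuousAt) (by simp [ENNReal.zero_rpow_of_pos hl0])]
  refine ENNReal.mul_le_of_forall_lt fun a ha b hb => ?_
  obtain ⟨m, hm⟩ := lt_iSup_iff.1 ha
  obtain ⟨n, hn⟩ := lt_iSup_iff.1 hb
  refine (mul_le_mul' hm.le hn.le).trans ?_
  refine (mul_le_mul' (ENNReal.rpow_le_rpow (hmono f (le_max_left m n)) h1.le)
    (ENNReal.rpow_le_rpow (hmono g (le_max_right m n)) hl0.le)).trans ?_
  refine rpow_lintegral_mul_le_of_bounded hl0 hl1 (hf.min measurable_const)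
    (hg.min measurable_const) hh (ENNReal.natCast_ne_top (max m n)) (fun _ => min_le_right _ _)
    (fun _ => min_le_right _ _) fun x y => le_trans ?_ (hfg x y)
  exact mul_le_mul' (ENNReal.rpow_le_rpow (min_le_left _ _) h1.le)
    (ENNReal.rpow_le_rpow (min_le_left _ _) hl0.le)

theorem PrekopaLeindler.prod {E F : Type*} [AddCommGroup E] [Module ℝ E] [MeasureSpace E]
    [AddCommGroup F] [Module ℝ F] [MeasureSpace F] [SFinite (volume : Measure E)]
    [SFinite (volume : Measure F)]
    (hE : PrekopaLeindler E) (hF : PrekopaLeindler F) : PrekopaLeindler (E × F) := by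
  intro l hl0 hl1 f g h hf hg hh hfg
  rw [Measure.volume_eq_prod, lintegral_prod _ hf.aemeasurable, lintegral_prod _ hg.aemeasurable,
    lintegral_prod _ hh.aemeasurable]
  refine hE l hl0 hl1 _ _ _ hf.lintegral_prod_right' hg.lintegral_prod_right'
    hh.lintegral_prod_right' fun x y => ?_
  exact hF l hl0 hl1 _ _ _ (hf.comp measurable_prodMk_left) (hg.comp measurable_prodMk_left)
    (hh.comp measurable_prodMk_left) fun s t => hfg (x, s) (y, t)

theorem prekopaLeindler_pi (m : ℕ) : PrekopaLeindler (Fin m → ℝ) := by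
  induction m with
  | zero =>
    intro l hl0 hl1 f g h hf hg hh hfg
    simp only [volume_pi, Measure.pi_of_empty _ (0 : Fin 0 → ℝ), lintegral_dirac]
    exact (hfg 0 0).trans (le_of_eq (congrArg h (Subsingleton.elim _ _)))
  | succ m ih =>
    intro l hl0 hl1 f g h hf hg hh hfg
    set e := (MeasurableEquiv.piFinSuccAbove (fun _ : Fin (m + 1) => ℝ) 0).symm with he
    have hmp : MeasurePreserving e :=
      (volume_preserving_piFinSuccAbove (fun _ : Fin (m + 1) => ℝ) 0).symm _
    rw [← hmp.lintegral_comp hf, ← hmp.lintegral_comp hg, ← hmp.lintegral_comp hh]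
    refine prekopaLeindler_real.prod ih l hl0 hl1 _ _ _ (hf.comp e.measurable)
      (hg.comp e.measurable) (hh.comp e.measurable) fun x y => ?_
    refine (hfg _ _).trans (le_of_eq (congrArg h ?_))
    ext i
    refine Fin.cases ?_ (fun j => ?_) i <;>
      simp [he, MeasurableEquiv.piFinSuccAbove]

end PrekopaLeindler

/-- The integral of `f` over the slice of `S` above `t`. -/
noncomputable def sliceIntegral {E : Type*} [MeasureSpace E] (S : Set (ℝ × E)) (f : ℝ × E → ℝ)
    (t : ℝ) : ℝ :=
  ∫ y, S.indicator f (t, y)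

section Slices

variable {m : ℕ} {S : Set (ℝ × (Fin m → ℝ))} {f : ℝ × (Fin m → ℝ) → ℝ} {M : ℝ}

lemma ContinuousOn.measurable_indicator_of_isOpen {X : Type*} [TopologicalSpace X]
    [MeasurableSpace X] [BorelSpace X] {S : Set X} {f : X → ℝ} (hf : ContinuousOn f S)
    (hS : IsOpen S) : Measurable (S.indicator f) := by
  classical
  have := ContinuousOn.measurable_piecewise (g := (0 : X → ℝ)) hf continuousOn_const
    hS.measurableSet
  rwa [Set.piecewise_eq_indicator] at this

lemma Bornology.IsBounded.integrableOn_of_norm_le {X : Type*} [PseudoMetricSpace X] [ProperSpace X]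
    [MeasureSpace X] [BorelSpace X]
    [IsFiniteMeasureOnCompacts (volume : Measure X)] {S : Set X} {f : X → ℝ} {M : ℝ}
    (hb : Bornology.IsBounded S) (hS : IsOpen S) (hf : ContinuousOn f S)
    (hM : ∀ z ∈ S, |f z| ≤ M) : IntegrableOn f S := by
  have : IsFiniteMeasure (volume.restrict S) := ⟨by simpa using hb.measure_lt_top⟩
  refine Integrable.of_bound ?_ M
    ((ae_restrict_mem hS.measurableSet).mono fun x hx => hM x hx)
  exact (aestronglyMeasurable_indicator_iff hS.measurableSet).1
    (hf.measurable_indicator_of_isOpen hS).aestronglyMeasurable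

lemma integrable_sliceIntegral (hS : MeasurableSet S) (hf : IntegrableOn f S) :
    Integrable (sliceIntegral S f) := by
  have h : Integrable (S.indicator f) := (integrable_indicator_iff hS).2 hf
  exact h.integral_prod_left

lemma integral_sliceIntegral (hS : MeasurableSet S) (hf : IntegrableOn f S) :
    ∫ t, sliceIntegral S f t = ∫ z in S, f z := by
  have h : Integrable (S.indicator f) := (integrable_indicator_iff hS).2 hf
  rw [← integral_indicator hS]
  exact (integral_prod _ h).symm

lemma sliceIntegral_eq_zero_of_notMem {t : ℝ} (ht : t ∉ Prod.fst '' S) :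
    sliceIntegral S f t = 0 := by
  unfold sliceIntegral
  rw [integral_eq_zero_of_ae]
  filter_upwards with y
  exact indicator_of_notMem (fun h => ht ⟨_, h, rfl⟩) _

lemma Convex.notMem_closure_of_slice {t : ℝ} {y : Fin m → ℝ} (hSo : IsOpen S) (hSc : Convex ℝ S)
    (ht : t ∈ Prod.fst '' S) (hy : y ∉ closure (Prod.mk t ⁻¹' S)) : (t, y) ∉ closure S := by
  intro h
  obtain ⟨⟨t', y0⟩, h0, rfl⟩ := ht
  apply hy
  have hseg := hSc.openSegment_interior_closure_subset_interior
    (by rwa [hSo.interior_eq] : (t', y0) ∈ interior S) h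
  have hlim : Tendsto (fun s : ℝ => (1 - s) • y + s • y0) (𝓝[>] 0) (𝓝 y) := by
    have : Continuous (fun s : ℝ => (1 - s) • y + s • y0) := by fun_prop
    have h2 := this.tendsto 0
    simp only [sub_zero, one_smul, zero_smul, add_zero] at h2
    exact h2.mono_left nhdsWithin_le_nhds
  refine mem_closure_of_tendsto hlim ?_
  filter_upwards [Ioo_mem_nhdsGT (zero_lt_one' ℝ)] with s hs
  have : s • (t', y0) + (1 - s) • (t', y) ∈ interior S :=
    hseg ⟨s, 1 - s, hs.1, by linarith [hs.2], by ring, rfl⟩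
  rw [hSo.interior_eq] at this
  have e : s • (t', y0) + (1 - s) • (t', y) = (t', (1 - s) • y + s • y0) := by
    ext <;> simp <;> ring
  rwa [e] at this

lemma continuousOn_sliceIntegral (hSo : IsOpen S) (hSc : Convex ℝ S)
    (hSb : Bornology.IsBounded S) (hf : ContinuousOn f S) (hM : ∀ z ∈ S, |f z| ≤ M) :
    ContinuousOn (sliceIntegral S f) (Prod.fst '' S) := by
  intro t ht
  have hopen : IsOpen (Prod.fst '' S) := isOpenMap_fst _ hSo
  refine ContinuousAt.continuousWithinAt ?_
  have hsl_open : IsOpen (Prod.mk t ⁻¹' S) := hSo.preimage (by fun_prop)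
  have hsl_conv : Convex ℝ (Prod.mk t ⁻¹' S) := by
    intro x hx y hy a b ha hb hab
    have := hSc hx hy ha hb hab
    have e : a • (t, x) + b • (t, y) = (t, a • x + b • y) := by
      ext
      · simp [← add_mul, hab]
      · simp
    rwa [e] at this
  refine continuousAt_of_dominated (bound := (Prod.snd '' S).indicator fun _ => M) ?_ ?_ ?_ ?_
  · exact Eventually.of_forall fun s =>
      ((hf.measurable_indicator_of_isOpen hSo).comp (by fun_prop)).aestronglyMeasurable
  · refine Eventually.of_forall fun s => Eventually.of_forall fun y => ?_
    by_cases h : (s, y) ∈ S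
    · rw [indicator_of_mem h, indicator_of_mem (mem_image_of_mem Prod.snd h)]
      exact hM _ h
    · rw [indicator_of_notMem h, norm_zero]
      refine indicator_nonneg ?_ _
      rintro _ ⟨z, hz, rfl⟩
      exact (abs_nonneg _).trans (hM z hz)
  · have hb2 : Bornology.IsBounded (Prod.snd '' S) := hSb.image_snd
    rw [integrable_indicator_iff (isOpenMap_snd _ hSo).measurableSet]
    exact integrableOn_const hb2.measure_lt_top.ne
  · have hfr : ∀ᵐ y, y ∉ frontier (Prod.mk t ⁻¹' S) :=
      measure_eq_zero_iff_ae_notMem.1 (hsl_conv.addHaar_frontier volume)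
    filter_upwards [hfr] with y hy
    by_cases h : (t, y) ∈ S
    · have h1 : ContinuousAt f (t, y) := hf.continuousAt (hSo.mem_nhds h)
      have h2 : ContinuousAt (fun s : ℝ => (s, y)) t := by fun_prop
      have h3 : ContinuousAt (fun s : ℝ => f (s, y)) t := h1.comp (f := fun s : ℝ => (s, y)) h2
      refine h3.congr ?_
      filter_upwards [h2.preimage_mem_nhds (hSo.mem_nhds h)] with s hs
      exact (indicator_of_mem (s := S) hs f).symm
    · have hyc : y ∉ closure (Prod.mk t ⁻¹' S) := by
        intro hc
        exact hy ⟨hc, fun hi => h (show y ∈ Prod.mk t ⁻¹' S from interior_subset hi)⟩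
      have h1 := hSc.notMem_closure_of_slice hSo ht hyc
      have h2 : ContinuousAt (fun s : ℝ => (s, y)) t := by fun_prop
      refine (continuousAt_const (y := (0 : ℝ))).congr ?_
      filter_upwards [h2.preimage_mem_nhds (isClosed_closure.isOpen_compl.mem_nhds h1)] with s hs
      exact (indicator_of_notMem (fun h' => hs (subset_closure h')) f).symm

lemma exists_image_fst_eq_Ioo (hSo : IsOpen S) (hSc : Convex ℝ S)
    (hSb : Bornology.IsBounded S) (hne : S.Nonempty) :
    ∃ a b, a < b ∧ Prod.fst '' S = Ioo a b := by
  set T := Prod.fst '' S with hT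
  have hTo : IsOpen T := isOpenMap_fst _ hSo
  have hTc : Convex ℝ T := hSc.linear_image (LinearMap.fst ℝ ℝ _)
  have hTb : Bornology.IsBounded T := hSb.image_fst
  have hTn : T.Nonempty := hne.image _
  have h1 := _root_.IsConnected.Ioo_csInf_csSup_subset ⟨hTn, hTc.isPreconnected⟩ hTb.bddBelow
    hTb.bddAbove
  have h2 : T ⊆ Ioo (sInf T) (sSup T) := by
    intro x hx
    obtain ⟨e, he, hball⟩ := Metric.isOpen_iff.1 hTo x hx
    have h3 : x - e / 2 ∈ T := hball (by
      rw [Metric.mem_ball, Real.dist_eq, abs_lt]; constructor <;> linarith)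
    have h4 : x + e / 2 ∈ T := hball (by
      rw [Metric.mem_ball, Real.dist_eq, abs_lt]; constructor <;> linarith)
    have h5 := csInf_le hTb.bddBelow h3
    have h6 := le_csSup hTb.bddAbove h4
    exact ⟨by linarith, by linarith⟩
  obtain ⟨x, hx⟩ := hTn
  exact ⟨_, _, (h2 hx).1.trans (h2 hx).2, h2.antisymm h1⟩

end Slices

section Weight

variable {m : ℕ} {S S' : Set (ℝ × (Fin m → ℝ))}

lemma sliceIntegral_inter_fst_preimage (I : Set ℝ) (f : ℝ × (Fin m → ℝ) → ℝ) :
    sliceIntegral (S ∩ Prod.fst ⁻¹' I) f = I.indicator (sliceIntegral S f) := by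
  classical
  funext t
  by_cases ht : t ∈ I
  · rw [indicator_of_mem ht]
    unfold sliceIntegral
    congr 1
    funext y
    simp [indicator, ht]
  · rw [indicator_of_notMem ht]
    refine sliceIntegral_eq_zero_of_notMem ?_
    rintro ⟨z, hz, rfl⟩
    exact ht hz.2

lemma intervalIntegral_sliceIntegral_one (hSo : IsOpen S) (hSb : Bornology.IsBounded S) {c d : ℝ}
    (hcd : c ≤ d) :
    ∫ t in c..d, sliceIntegral S (fun _ => 1) t = volume.real (S ∩ Prod.fst ⁻¹' Ioc c d) := by
  have hm : MeasurableSet (S ∩ Prod.fst ⁻¹' Ioc c d) :=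
    hSo.measurableSet.inter (measurable_fst measurableSet_Ioc)
  have hfin : volume (S ∩ Prod.fst ⁻¹' Ioc c d) ≠ ⊤ :=
    (hSb.subset inter_subset_left).measure_lt_top.ne
  rw [intervalIntegral.integral_of_le hcd, ← integral_indicator measurableSet_Ioc,
    ← sliceIntegral_inter_fst_preimage,
    integral_sliceIntegral hm (integrableOn_const hfin)]
  simp

lemma sliceIntegral_one_nonneg (t : ℝ) : 0 ≤ sliceIntegral S (fun _ => 1) t :=
  integral_nonneg fun _ => indicator_nonneg (fun _ _ => zero_le_one) _

lemma sliceIntegral_one_eq (hSo : IsOpen S) (t : ℝ) :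
    sliceIntegral S (fun _ => 1) t = volume.real (Prod.mk t ⁻¹' S) := by
  have hm : MeasurableSet (Prod.mk t ⁻¹' S) :=
    (hSo.preimage (by fun_prop : Continuous (Prod.mk t))).measurableSet
  have : (fun y => S.indicator (fun _ => (1 : ℝ)) (t, y))
      = (Prod.mk t ⁻¹' S).indicator fun _ => (1 : ℝ) := rfl
  rw [sliceIntegral, this, integral_indicator hm]
  simp

lemma Bornology.IsBounded.slice (hSb : Bornology.IsBounded S) (t : ℝ) :
    Bornology.IsBounded (Prod.mk t ⁻¹' S) :=
  hSb.image_snd.subset fun y hy => ⟨(t, y), hy, rfl⟩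

lemma measureReal_inter_strip_rpow_le (hSo : IsOpen S) (hSc : Convex ℝ S)
    (hSb : Bornology.IsBounded S) (η : ℝ) {s t l : ℝ} (hl0 : 0 < l) (hl1 : l < 1) :
    volume.real (S ∩ Prod.fst ⁻¹' Ioc (s - η) (s + η)) ^ (1 - l) *
      volume.real (S ∩ Prod.fst ⁻¹' Ioc (t - η) (t + η)) ^ l ≤
    volume.real (S ∩ Prod.fst ⁻¹' Ioc ((1 - l) * s + l * t - η) ((1 - l) * s + l * t + η)) := by
  have hm : ∀ t : ℝ, MeasurableSet (S ∩ Prod.fst ⁻¹' Ioc (t - η) (t + η)) := fun t =>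
    hSo.measurableSet.inter (measurable_fst measurableSet_Ioc)
  have hfin : ∀ t : ℝ, volume (S ∩ Prod.fst ⁻¹' Ioc (t - η) (t + η)) ≠ ⊤ := fun t =>
    (hSb.subset inter_subset_left).measure_lt_top.ne
  have key := (prekopaLeindler_real.prod (prekopaLeindler_pi m)) l hl0 hl1
    ((S ∩ Prod.fst ⁻¹' Ioc (s - η) (s + η)).indicator 1)
    ((S ∩ Prod.fst ⁻¹' Ioc (t - η) (t + η)).indicator 1)
    ((S ∩ Prod.fst ⁻¹' Ioc ((1 - l) * s + l * t - η) ((1 - l) * s + l * t + η)).indicator 1)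
    (measurable_one.indicator (hm _)) (measurable_one.indicator (hm _))
    (measurable_one.indicator (hm _)) (by
      intro x y
      by_cases hx : x ∈ S ∩ Prod.fst ⁻¹' Ioc (s - η) (s + η)
      swap
      · rw [indicator_of_notMem hx, ENNReal.zero_rpow_of_pos (by linarith), zero_mul]
        exact bot_le
      by_cases hy : y ∈ S ∩ Prod.fst ⁻¹' Ioc (t - η) (t + η)
      swap
      · rw [indicator_of_notMem hy, ENNReal.zero_rpow_of_pos hl0, mul_zero]
        exact bot_le
      rw [indicator_of_mem hx, indicator_of_mem hy, indicator_of_mem]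
      · simp
      · refine ⟨hSc hx.1 hy.1 (by linarith) hl0.le (by ring), ?_⟩
        have h1 := hx.2
        have h2 := hy.2
        simp only [mem_preimage, mem_Ioc, Prod.fst_add, Prod.smul_fst, smul_eq_mul] at h1 h2 ⊢
        constructor <;> nlinarith)
  rw [lintegral_indicator_one (hm _), lintegral_indicator_one (hm _),
    lintegral_indicator_one (hm _)] at key
  have := ENNReal.toReal_mono (hfin _) key
  rwa [ENNReal.toReal_mul, ← ENNReal.toReal_rpow, ← ENNReal.toReal_rpow] at this

lemma exists_logConcave_weight (hSo : IsOpen S)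
    (hSo' : IsOpen S') (hSc' : Convex ℝ S') (hSb' : Bornology.IsBounded S') {η : ℝ} (hη : 0 < η)
    (hSS' : ∀ t y s, (t, y) ∈ S → |s| ≤ 2 * η → (t + s, y) ∈ S') {a b : ℝ} (hab : a < b)
    (hS : Prod.fst '' S = Ioo a b) :
    ∃ ρ ρ' : ℝ → ℝ, (∀ t ∈ Icc a b, 0 < ρ t) ∧ (∀ t ∈ Icc a b, HasDerivAt ρ (ρ' t) t) ∧
      ContinuousOn ρ' (Icc a b) ∧ ConcaveOn ℝ (Icc a b) (fun t => Real.log (ρ t)) ∧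
      (∀ t ∈ Ioo a b, sliceIntegral S (fun _ => 1) t ≤ ρ t) ∧
      ∫ t in a..b, ρ t ≤ volume.real S' := by
  set A := sliceIntegral S' (fun _ => 1) with hA
  have hAint : Integrable A :=
    integrable_sliceIntegral hSo'.measurableSet (integrableOn_const hSb'.measure_lt_top.ne)
  have hAi : ∀ c d, IntervalIntegrable A volume c d := fun c d => hAint.intervalIntegrable
  have hAcont : ContinuousOn A (Prod.fst '' S') :=
    continuousOn_sliceIntegral hSo' hSc' hSb' continuousOn_const (M := 1) (by simp)
  have hTo : IsOpen (Prod.fst '' S') := isOpenMap_fst _ hSo'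
  have hmem : ∀ t ∈ Icc a b, ∀ s, |s| ≤ η → t + s ∈ Prod.fst '' S' := by
    intro t ht s hs
    rw [← closure_Ioo hab.ne, ← hS] at ht
    obtain ⟨_, ⟨z, hz, rfl⟩, hdist⟩ := Metric.mem_closure_iff.1 ht η hη
    refine ⟨(z.1 + (t + s - z.1), z.2), hSS' _ _ _ hz ?_, by simp⟩
    rw [Real.dist_eq] at hdist
    have := abs_add_le (t - z.1) s
    have e : t + s - z.1 = t - z.1 + s := by ring
    rw [e]
    linarith
  have hApos : ∀ t ∈ Prod.fst '' S', 0 < A t := by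
    rintro _ ⟨z, hz, rfl⟩
    rw [hA, sliceIntegral_one_eq hSo', measureReal_def]
    refine ENNReal.toReal_pos ?_ (hSb'.slice _).measure_lt_top.ne
    exact ((hSo'.preimage (by fun_prop : Continuous (Prod.mk z.1))).measure_pos volume
      ⟨z.2, hz⟩).ne'
  set Φ : ℝ → ℝ := fun x => ∫ t in (0 : ℝ)..x, A t with hΦ
  have hΦd : ∀ x ∈ Prod.fst '' S', HasDerivAt Φ (A x) x := by
    intro x hx
    exact intervalIntegral.integral_hasDerivAt_right (hAi _ _)
      (hAint.aestronglyMeasurable.stronglyMeasurableAtFilter)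
      (hAcont.continuousAt (hTo.mem_nhds hx))
  have hΦs : ∀ x y, Φ y - Φ x = ∫ t in x..y, A t := fun x y =>
    intervalIntegral.integral_interval_sub_left (hAi _ _) (hAi _ _)
  have hΦc : Continuous Φ := intervalIntegral.continuous_primitive hAi 0
  have h2η : 0 < 2 * η := by linarith
  refine ⟨fun t => (Φ (t + η) - Φ (t - η)) / (2 * η), fun t => (A (t + η) - A (t - η)) / (2 * η),
    ?_, ?_, ?_, ?_, ?_, ?_⟩
  · intro t ht
    refine div_pos ?_ h2η
    rw [hΦs]
    refine intervalIntegral.intervalIntegral_pos_of_pos_on (hAi _ _) (fun x hx => ?_) (by linarith)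
    have := hmem t ht (x - t) (by rw [abs_le]; constructor <;> linarith [hx.1, hx.2])
    exact hApos x (by simpa using this)
  · intro t ht
    have h1 := hmem t ht η (by rw [abs_of_pos hη])
    have h2 := hmem t ht (-η) (by rw [abs_neg, abs_of_pos hη])
    exact (((hΦd _ h1).comp_add_const t η).sub
      ((hΦd (t - η) h2).comp_sub_const t η)).div_const _
  · refine ContinuousOn.div_const (ContinuousOn.sub ?_ ?_) _
    · refine hAcont.comp (by fun_prop) fun t ht => hmem t ht η (by rw [abs_of_pos hη])
    · refine hAcont.comp (by fun_prop) fun t ht =>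
        hmem t ht (-η) (by rw [abs_neg, abs_of_pos hη])
  · have hV : ∀ t, Φ (t + η) - Φ (t - η) =
        volume.real (S' ∩ Prod.fst ⁻¹' Ioc (t - η) (t + η)) := by
      intro t
      rw [hΦs, intervalIntegral_sliceIntegral_one hSo' hSb' (by linarith)]
    have hVpos : ∀ t ∈ Icc a b, 0 < Φ (t + η) - Φ (t - η) := by
      intro t ht
      rw [hΦs]
      refine intervalIntegral.intervalIntegral_pos_of_pos_on (hAi _ _) (fun x hx => ?_)
        (by linarith)
      have := hmem t ht (x - t) (by rw [abs_le]; constructor <;> linarith [hx.1, hx.2])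
      exact hApos x (by simpa using this)
    refine LinearOrder.concaveOn_of_lt (convex_Icc a b) ?_
    intro s hs t ht hst k l hk hl hkl
    obtain rfl : k = 1 - l := by linarith
    have hcm : (1 - l) * s + l * t ∈ Icc a b := convex_Icc a b hs ht hk.le hl.le hkl
    simp only [smul_eq_mul]
    rw [Real.log_div (hVpos s hs).ne' h2η.ne', Real.log_div (hVpos t ht).ne' h2η.ne',
      Real.log_div (hVpos _ hcm).ne' h2η.ne']
    have h1 := measureReal_inter_strip_rpow_le hSo' hSc' hSb' η (s := s) (t := t) hl
      (by linarith)
    rw [← hV, ← hV, ← hV] at h1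
    have h2 := Real.log_le_log (mul_pos (Real.rpow_pos_of_pos (hVpos s hs) _)
      (Real.rpow_pos_of_pos (hVpos t ht) _)) h1
    rw [Real.log_mul (Real.rpow_pos_of_pos (hVpos s hs) _).ne'
      (Real.rpow_pos_of_pos (hVpos t ht) _).ne', Real.log_rpow (hVpos s hs),
      Real.log_rpow (hVpos t ht)] at h2
    linarith
  · intro t ht
    rw [le_div_iff₀ h2η, hΦs]
    have h1 : ∫ x in (t - η)..(t + η), sliceIntegral S (fun _ => 1) t ≤
        ∫ x in (t - η)..(t + η), A x := by
      refine intervalIntegral.integral_mono_on (by linarith) (by simp) (hAi _ _) fun x hx => ?_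
      rw [hA, sliceIntegral_one_eq hSo', sliceIntegral_one_eq hSo]
      refine measureReal_mono (fun y hy => ?_) (hSb'.slice _).measure_lt_top.ne
      have := hSS' t y (x - t) hy (by rw [abs_le]; constructor <;> linarith [hx.1, hx.2])
      simpa using this
    rw [intervalIntegral.integral_const, smul_eq_mul] at h1
    linarith
  · have hΦi : ∀ c d, IntervalIntegrable Φ volume c d := fun c d => hΦc.intervalIntegrable c d
    have hΦp : ∀ c d e, IntervalIntegrable (fun x => Φ (x + e)) volume c d := fun c d e =>
      (hΦc.comp (continuous_id.add continuous_const)).intervalIntegrable c d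
    have hΦm : ∀ c d e, IntervalIntegrable (fun x => Φ (x - e)) volume c d := fun c d e =>
      (hΦc.comp (continuous_id.sub continuous_const)).intervalIntegrable c d
    rw [intervalIntegral.integral_div, div_le_iff₀ h2η,
      intervalIntegral.integral_sub (hΦp _ _ _) (hΦm _ _ _),
      intervalIntegral.integral_comp_add_right, intervalIntegral.integral_comp_sub_right,
      intervalIntegral.integral_interval_sub_interval_comm' (hΦi _ _) (hΦi _ _) (hΦi _ _)]
    have e1 : ∫ x in (b - η)..(b + η), Φ x = ∫ s in (-η)..η, Φ (s + b) := by
      rw [intervalIntegral.integral_comp_add_right]; congr 1 <;> ring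
    have e2 : ∫ x in (a - η)..(a + η), Φ x = ∫ s in (-η)..η, Φ (s + a) := by
      rw [intervalIntegral.integral_comp_add_right]; congr 1 <;> ring
    rw [e1, e2, ← intervalIntegral.integral_sub (hΦp _ _ _) (hΦp _ _ _)]
    have h1 : ∫ s in (-η)..η, (Φ (s + b) - Φ (s + a)) ≤ ∫ s in (-η)..η, volume.real S' := by
      refine intervalIntegral.integral_mono_on (by linarith)
        ((hΦp _ _ _).sub (hΦp _ _ _))
        (by simp) fun s _ => ?_
      rw [hΦs, intervalIntegral_sliceIntegral_one hSo' hSb' (by linarith)]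
      exact measureReal_mono inter_subset_left hSb'.measure_lt_top.ne
    rw [intervalIntegral.integral_const, smul_eq_mul] at h1
    linarith

end Weight

lemma integral_exp_mul_abs_rpow_le_of_lt_mul_pi_p {p q a b C : ℝ} (hpq : p.HolderConjugate q)
    (hab : a < b) (hC : 0 < C) (hlen : b - a < C * pi_p p) {h k F g : ℝ → ℝ}
    (hh : ContinuousOn h (Icc a b)) (hk : ContinuousOn k (Icc a b))
    (hhk : ∀ x ∈ Ioo a b, HasDerivAt h (k x) x) (hmono : MonotoneOn k (Icc a b))
    (hF : ContinuousOn F (Icc a b)) (hFa : F a = 0) (hFb : F b = 0)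
    (hFg : ∀ x ∈ Ioo a b, HasDerivAt F (g x) x)
    (hg : IntegrableOn (fun x => Real.exp (h x) * |g x| ^ q) (Icc a b)) :
    C⁻¹ ^ q * ∫ x in a..b, Real.exp (h x) * |F x| ^ q ≤
      ∫ x in a..b, Real.exp (h x) * |g x| ^ q := by
  have hp := hpq.lt
  have hq := hpq.symm.lt
  have hp0 : 0 < p := by linarith
  have hq0 : 0 < q := by linarith
  have hpq1 : (p - 1) * (q - 1) = 1 := by
    have := hpq.mul_eq_add
    linarith
  have hp1 : 0 < p - 1 := by linarith
  have hq1 : 0 < q - 1 := by linarith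
  set I := Real.pi / (p * Real.sin (Real.pi / p)) with hI
  have hpi : pi_p p = 2 * I * (p - 1) ^ (1 / p) := by
    rw [pi_p, hI]; ring
  have hprod : (p - 1) ^ (1 / p) * (q - 1) ^ (1 / p) = 1 := by
    rw [← Real.mul_rpow hp1.le hq1.le, hpq1, Real.one_rpow]
  have hω : 0 < C⁻¹ * (q - 1) ^ (1 / p) := mul_pos (inv_pos.2 hC) (Real.rpow_pos_of_pos hq1 _)
  have hlt : C⁻¹ * (q - 1) ^ (1 / p) * (b - a) / 2 < I := by
    have h1 : C⁻¹ * (q - 1) ^ (1 / p) * (b - a) < C⁻¹ * (q - 1) ^ (1 / p) * (C * pi_p p) :=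
      mul_lt_mul_of_pos_left hlen hω
    have h2 : C⁻¹ * (q - 1) ^ (1 / p) * (C * pi_p p) = 2 * I := by
      rw [hpi]
      calc C⁻¹ * (q - 1) ^ (1 / p) * (C * (2 * I * (p - 1) ^ (1 / p)))
          = (C⁻¹ * C) * ((p - 1) ^ (1 / p) * (q - 1) ^ (1 / p)) * (2 * I) := by ring
        _ = 2 * I := by rw [hprod, inv_mul_cancel₀ hC.ne']; ring
    linarith
  obtain ⟨B, hB, hBy⟩ := exists_le_integral_inv_one_add_rpow hp hlt
  have key := integral_exp_mul_abs_rpow_le hab.le hω hB hpq (by linarith) hh hk hhk hmono hF hFa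
    hFb hFg hg
  have hconst : (C⁻¹ * (q - 1) ^ (1 / p)) ^ q * (q - 1) ^ (1 - q) = C⁻¹ ^ q := by
    rw [Real.mul_rpow (inv_pos.2 hC).le (Real.rpow_nonneg hq1.le _), ← Real.rpow_mul hq1.le,
      mul_assoc, ← Real.rpow_add hq1]
    have : 1 / p * q + (1 - q) = 0 := by
      have := hpq.symm.div_conj_eq_sub_one
      rw [one_div_mul_eq_div, this]; ring
    rw [this, Real.rpow_zero, mul_one]
  rwa [hconst] at key

lemma neg_mul_le_rpow_add_rpow {p q C r x y : ℝ} (hpq : p.HolderConjugate q) (hC : 0 < C)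
    (hr : 0 < r) :
    -(x * y) ≤ C ^ p / p * (r * |y| ^ p) + 1 / q * (C⁻¹ ^ q * (r ^ (1 - q) * |x| ^ q)) := by
  have hp := hpq.lt
  have hq := hpq.symm.lt
  have hp0 : 0 < p := by linarith
  have hq0 : 0 < q := by linarith
  have h1 := Real.young_inequality_of_nonneg (a := C * r ^ (1 / p) * |y|)
    (b := C⁻¹ * r ^ (-(1 / p)) * |x|) (by positivity) (by positivity) hpq
  have h2 : C * r ^ (1 / p) * |y| * (C⁻¹ * r ^ (-(1 / p)) * |x|) = |x * y| := by
    rw [abs_mul, Real.rpow_neg hr.le]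
    have : r ^ (1 / p) ≠ 0 := (Real.rpow_pos_of_pos hr _).ne'
    field_simp
  have h3 : (C * r ^ (1 / p) * |y|) ^ p = C ^ p * (r * |y| ^ p) := by
    rw [Real.mul_rpow (by positivity) (abs_nonneg _), Real.mul_rpow hC.le (by positivity),
      ← Real.rpow_mul hr.le, one_div_mul_cancel hp0.ne', Real.rpow_one, mul_assoc]
  have h4 : (C⁻¹ * r ^ (-(1 / p)) * |x|) ^ q = C⁻¹ ^ q * (r ^ (1 - q) * |x| ^ q) := by
    rw [Real.mul_rpow (by positivity) (abs_nonneg _), Real.mul_rpow (by positivity) (by positivity),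
      ← Real.rpow_mul hr.le, mul_assoc]
    have : -(1 / p) * q = 1 - q := by
      have := hpq.symm.div_conj_eq_sub_one
      rw [neg_mul, one_div_mul_eq_div, this]; ring
    rw [this]
  rw [h2, h3, h4] at h1
  calc -(x * y) ≤ |x * y| := neg_le_abs _
    _ ≤ _ := h1
    _ = _ := by ring

lemma integral_mul_le_of_weight {p q a b C N : ℝ} (hpq : p.HolderConjugate q)
    (hab : a < b) (hC : 0 < C) (hlen : b - a < C * pi_p p) {ρ ρ' g v v' : ℝ → ℝ}
    (hρ : ∀ t ∈ Icc a b, 0 < ρ t) (hρ' : ∀ t ∈ Icc a b, HasDerivAt ρ (ρ' t) t)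
    (hρ'c : ContinuousOn ρ' (Icc a b))
    (hlog : ConcaveOn ℝ (Icc a b) (fun t => Real.log (ρ t)))
    (hgc : ContinuousOn g (Ioo a b)) (hgi : Integrable g) (hgN : ∀ t, |g t| ≤ N)
    (hg0 : ∫ t in a..b, g t = 0)
    (hv : ∀ t ∈ Icc a b, HasDerivAt v (v' t) t) (hv' : ContinuousOn v' (Icc a b)) :
    ∫ t in a..b, g t * v t ≤
      C ^ p / p * (∫ t in a..b, ρ t * |v' t| ^ p) +
        1 / q * ∫ t in a..b, ρ t ^ (1 - q) * |g t| ^ q := by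
  have hp := hpq.lt
  have hq := hpq.symm.lt
  have hp0 : 0 < p := by linarith
  have hq0 : 0 < q := by linarith
  have huIcc : uIcc a b = Icc a b := uIcc_of_le hab.le
  have hρc : ContinuousOn ρ (Icc a b) := fun t ht => (hρ' t ht).continuousAt.continuousWithinAt
  have hvc : ContinuousOn v (Icc a b) := fun t ht => (hv t ht).continuousAt.continuousWithinAt
  have hgii : ∀ c d, IntervalIntegrable g volume c d := fun c d => hgi.intervalIntegrable
  set F : ℝ → ℝ := fun x => ∫ t in a..x, g t with hF
  have hFc : Continuous F := intervalIntegral.continuous_primitive hgii a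
  have hFa : F a = 0 := intervalIntegral.integral_same
  have hFb : F b = 0 := hg0
  have hFd : ∀ x ∈ Ioo a b, HasDerivAt F (g x) x := fun x hx =>
    intervalIntegral.integral_hasDerivAt_right (hgii _ _)
      (hgi.aestronglyMeasurable.stronglyMeasurableAtFilter)
      (hgc.continuousAt (isOpen_Ioo.mem_nhds hx))
  have hexp : ∀ t ∈ Icc a b, Real.exp ((1 - q) * Real.log (ρ t)) = ρ t ^ (1 - q) := by
    intro t ht
    rw [Real.rpow_def_of_pos (hρ t ht), mul_comm]
  have hdlog : ∀ t ∈ Icc a b, HasDerivAt (fun t => Real.log (ρ t)) (ρ' t / ρ t) t :=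
    fun t ht => (hρ' t ht).log (hρ t ht).ne'
  have hrc : ContinuousOn (fun t => ρ t ^ (1 - q)) (Icc a b) :=
    hρc.rpow_const fun t ht => Or.inl (hρ t ht).ne'
  have hgint : IntegrableOn (fun t => ρ t ^ (1 - q) * |g t| ^ q) (Icc a b) := by
    have h1 : IntegrableOn (fun t => |g t| ^ q) (Icc a b) := by
      refine Integrable.of_bound
        ((hgi.aestronglyMeasurable.aemeasurable.abs.pow_const q).aestronglyMeasurable.restrict)
        (N ^ q) (Eventually.of_forall fun t => ?_)
      rw [Real.norm_of_nonneg (by positivity)]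
      exact Real.rpow_le_rpow (abs_nonneg _) (hgN t) hq0.le
    exact h1.continuousOn_mul hrc isCompact_Icc
  have hdir := integral_exp_mul_abs_rpow_le_of_lt_mul_pi_p hpq hab hC hlen
    (h := fun t => (1 - q) * Real.log (ρ t)) (k := fun t => (1 - q) * (ρ' t / ρ t))
    (F := F) (g := g)
    (continuousOn_const.mul (hρc.log fun t ht => (hρ t ht).ne'))
    (continuousOn_const.mul (hρ'c.div hρc fun t ht => (hρ t ht).ne'))
    (fun t ht => (hdlog t (Ioo_subset_Icc_self ht)).const_mul _)
    (by
      intro s hs t ht hst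
      have := hlog.antitoneOn_deriv (fun x hx => (hdlog x hx).differentiableAt) hs ht hst
      rw [(hdlog s hs).deriv, (hdlog t ht).deriv] at this
      have hq' : 1 - q ≤ 0 := by linarith
      exact mul_le_mul_of_nonpos_left this hq')
    hFc.continuousOn hFa hFb hFd
    (hgint.congr_fun (fun t ht => by simp only [hexp t ht]) measurableSet_Icc)
  have hcongr : ∀ f : ℝ → ℝ, ∫ t in a..b, Real.exp ((1 - q) * Real.log (ρ t)) * |f t| ^ q =
      ∫ t in a..b, ρ t ^ (1 - q) * |f t| ^ q := fun f =>
    intervalIntegral.integral_congr fun t ht => by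
      rw [huIcc] at ht
      simp only [hexp t ht]
  rw [hcongr, hcongr] at hdir
  have hibp := intervalIntegral.integral_mul_deriv_eq_deriv_mul_of_hasDerivAt (a := a) (b := b)
    (u := F) (v := v) (u' := g) (v' := v') hFc.continuousOn (huIcc ▸ hvc)
    (by rwa [min_eq_left hab.le, max_eq_right hab.le])
    (by
      rw [min_eq_left hab.le, max_eq_right hab.le]
      exact fun t ht => hv t (Ioo_subset_Icc_self ht))
    (hgii _ _) ((huIcc ▸ hv').intervalIntegrable)
  rw [hFa, hFb, zero_mul, zero_mul, sub_zero, zero_sub] at hibp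
  have hFq : ContinuousOn (fun t => ρ t ^ (1 - q) * |F t| ^ q) (Icc a b) :=
    hrc.mul (hFc.abs.rpow_const fun _ => Or.inr hq0.le).continuousOn
  have hvp : ContinuousOn (fun t => ρ t * |v' t| ^ p) (Icc a b) :=
    hρc.mul (hv'.abs.rpow_const fun _ _ => Or.inr hp0.le)
  have hFqi : IntervalIntegrable (fun t => ρ t ^ (1 - q) * |F t| ^ q) volume a b :=
    (huIcc ▸ hFq).intervalIntegrable
  have hvpi : IntervalIntegrable (fun t => ρ t * |v' t| ^ p) volume a b :=
    (huIcc ▸ hvp).intervalIntegrable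
  have hFv : IntervalIntegrable (fun t => -(F t * v' t)) volume a b :=
    (huIcc ▸ (hFc.continuousOn.mul hv').neg : ContinuousOn _ (uIcc a b)).intervalIntegrable
  have hyoung : ∫ t in a..b, -(F t * v' t) ≤ ∫ t in a..b,
      (C ^ p / p * (ρ t * |v' t| ^ p) + 1 / q * (C⁻¹ ^ q * (ρ t ^ (1 - q) * |F t| ^ q))) :=
    intervalIntegral.integral_mono_on hab.le hFv
      ((hvpi.const_mul _).add ((hFqi.const_mul _).const_mul _))
      fun t ht => neg_mul_le_rpow_add_rpow hpq hC (hρ t ht)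
  rw [intervalIntegral.integral_neg, hibp, neg_neg, intervalIntegral.integral_add
    (hvpi.const_mul _) ((hFqi.const_mul _).const_mul _), intervalIntegral.integral_const_mul,
    intervalIntegral.integral_const_mul, intervalIntegral.integral_const_mul] at hyoung
  refine hyoung.trans ?_
  gcongr

section Thin

variable {m : ℕ} {S : Set (ℝ × (Fin m → ℝ))}

lemma setIntegral_eq_intervalIntegral_sliceIntegral {f : ℝ × (Fin m → ℝ) → ℝ} (hSo : IsOpen S)
    (hf : IntegrableOn f S) {a b : ℝ} (hab : a < b) (hS : Prod.fst '' S = Ioo a b) :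
    ∫ z in S, f z = ∫ t in a..b, sliceIntegral S f t := by
  rw [← integral_sliceIntegral hSo.measurableSet hf, intervalIntegral.integral_of_le hab.le,
    integral_Ioc_eq_integral_Ioo, setIntegral_eq_integral_of_forall_compl_eq_zero]
  intro t ht
  exact sliceIntegral_eq_zero_of_notMem (hS ▸ ht)

lemma sliceIntegral_eq_setIntegral {f : ℝ × (Fin m → ℝ) → ℝ} (hSo : IsOpen S) (t : ℝ) :
    sliceIntegral S f t = ∫ y in Prod.mk t ⁻¹' S, f (t, y) := by
  have hm : MeasurableSet (Prod.mk t ⁻¹' S) :=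
    (hSo.preimage (by fun_prop : Continuous (Prod.mk t))).measurableSet
  rw [← integral_indicator hm]
  rfl

lemma abs_abs_rpow_mul_self {p : ℝ} (hp : 2 ≤ p) (x : ℝ) :
    |(|x| ^ (p - 2) * x)| = |x| ^ (p - 1) := by
  rw [abs_mul, abs_of_nonneg (Real.rpow_nonneg (abs_nonneg x) _)]
  have : p - 1 = p - 2 + 1 := by ring
  rw [this, Real.rpow_add_one' (abs_nonneg x) (by linarith)]

lemma abs_rpow_mul_self_mul_self {p : ℝ} (hp : 2 ≤ p) (x : ℝ) :
    |x| ^ (p - 2) * x * x = |x| ^ p := by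
  have h1 : p = p - 2 + 2 := by ring
  conv_rhs => rw [h1, Real.rpow_add' (abs_nonneg x) (by linarith)]
  rw [Real.rpow_two, sq_abs]; ring

lemma continuous_abs_rpow_mul_self {p : ℝ} (hp : 2 ≤ p) :
    Continuous fun x : ℝ => |x| ^ (p - 2) * x :=
  (continuous_abs.rpow_const fun _ => Or.inr (by linarith)).mul continuous_id

lemma abs_sliceIntegral_rpow_le {p q : ℝ} (hpq : p.HolderConjugate q) (hp2 : 2 ≤ p)
    (hSo : IsOpen S) (hSb : Bornology.IsBounded S) {w : ℝ × (Fin m → ℝ) → ℝ}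
    (hw : ContinuousOn w S) {M : ℝ} (hM : ∀ z ∈ S, |w z| ≤ M) (t : ℝ) :
    |sliceIntegral S (fun z => |w z| ^ (p - 2) * w z) t| ^ q ≤
      sliceIntegral S (fun z => |w z| ^ p) t * sliceIntegral S (fun _ => 1) t ^ (q - 1) := by
  have hq := hpq.symm.lt
  have hq0 : 0 < q := by linarith
  set T := Prod.mk t ⁻¹' S with hT
  have hTo : IsOpen T := hSo.preimage (by fun_prop : Continuous (Prod.mk t))
  have hTb : Bornology.IsBounded T := hSb.slice t
  have : IsFiniteMeasure (volume.restrict T) := ⟨by simpa using hTb.measure_lt_top⟩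
  rw [sliceIntegral_eq_setIntegral hSo, sliceIntegral_eq_setIntegral hSo,
    sliceIntegral_eq_setIntegral hSo]
  have hwc : ContinuousOn (fun y => w (t, y)) T := hw.comp (by fun_prop) fun y hy => hy
  have hmem : MemLp (fun y => |w (t, y)| ^ (p - 1)) (ENNReal.ofReal q) (volume.restrict T) := by
    refine MemLp.of_bound ((hwc.abs.rpow_const fun _ _ => Or.inr (by linarith)).aestronglyMeasurable
      hTo.measurableSet) (M ^ (p - 1)) ?_
    filter_upwards [ae_restrict_mem hTo.measurableSet] with y hy
    rw [Real.norm_of_nonneg (by positivity)]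
    exact Real.rpow_le_rpow (abs_nonneg _) (hM _ hy) (by linarith)
  have h1 := integral_mul_le_Lp_mul_Lq_of_nonneg hpq.symm (μ := volume.restrict T)
    (f := fun y => |w (t, y)| ^ (p - 1)) (g := fun _ => 1)
    (Eventually.of_forall fun y => by positivity) (Eventually.of_forall fun y => zero_le_one)
    hmem (memLp_const 1)
  simp only [mul_one, Real.one_rpow] at h1
  have h2 : |∫ y in T, |w (t, y)| ^ (p - 2) * w (t, y)| ≤ ∫ y in T, |w (t, y)| ^ (p - 1) := by
    refine abs_integral_le_integral_abs.trans (le_of_eq ?_)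
    exact integral_congr_ae (Eventually.of_forall fun y => abs_abs_rpow_mul_self hp2 _)
  have h3 : ∫ y in T, (|w (t, y)| ^ (p - 1)) ^ q = ∫ y in T, |w (t, y)| ^ p := by
    refine integral_congr_ae (Eventually.of_forall fun y => ?_)
    simp only
    rw [← Real.rpow_mul (abs_nonneg _), hpq.sub_one_mul_conj]
  rw [h3] at h1
  have hX : 0 ≤ ∫ y in T, |w (t, y)| ^ p := integral_nonneg fun y => by positivity
  have hA : (0 : ℝ) ≤ ∫ y in T, 1 := integral_nonneg fun y => zero_le_one
  refine (Real.rpow_le_rpow (abs_nonneg _) (h2.trans h1) hq0.le).trans (le_of_eq ?_)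
  rw [Real.mul_rpow (by positivity) (by positivity), ← Real.rpow_mul hX, ← Real.rpow_mul hA,
    one_div_mul_cancel hq0.ne', Real.rpow_one]
  congr 2
  rw [one_div_mul_eq_div, hpq.symm.div_conj_eq_sub_one]

lemma integral_abs_rpow_le_of_thickening {p q C : ℝ} (hpq : p.HolderConjugate q) (hp2 : 2 ≤ p)
    (hC : 0 < C) (hSo : IsOpen S) (hSc : Convex ℝ S) (hSb : Bornology.IsBounded S)
    {a b : ℝ} (hab : a < b) (hS : Prod.fst '' S = Ioo a b) (hlen : b - a < C * pi_p p)
    {w : ℝ × (Fin m → ℝ) → ℝ} (hw : ContinuousOn w S) {M : ℝ} (hM : ∀ z ∈ S, |w z| ≤ M)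
    (hw0 : ∫ z in S, |w z| ^ (p - 2) * w z = 0) {v v' : ℝ → ℝ}
    (hv : ∀ t ∈ Icc a b, HasDerivAt v (v' t) t) (hv' : ContinuousOn v' (Icc a b))
    {M' : ℝ} (hM' : ∀ t ∈ Icc a b, |v' t| ^ p ≤ M')
    {ε ε' : ℝ} (hε : ∀ z ∈ S, |w z - v z.1| ≤ ε) {G : ℝ × (Fin m → ℝ) → ℝ}
    (hG : IntegrableOn G S) (hGε : ∀ z ∈ S, |v' z.1| ^ p ≤ G z + ε') {δ : ℝ} (hδ : 0 < δ) :
    ∫ z in S, |w z| ^ p ≤ p * (M ^ (p - 1) * ε * volume.real S) +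
      C ^ p * ((∫ z in S, G z) + ε' * volume.real S +
        M' * (volume.real (Metric.thickening δ S) - volume.real S)) := by
  have hp := hpq.lt
  have hq := hpq.symm.lt
  have hp0 : 0 < p := by linarith
  have hq0 : 0 < q := by linarith
  have hSfin := hSb.measure_lt_top (μ := volume).ne
  have hSne : S.Nonempty := by
    have : (Prod.fst '' S).Nonempty := hS ▸ nonempty_Ioo.2 hab
    exact this.of_image
  obtain ⟨z0, hz0⟩ := hSne
  have hM0 : 0 ≤ M := (abs_nonneg _).trans (hM z0 hz0)
  have hfst : ∀ z ∈ S, z.1 ∈ Ioo a b := fun z hz => hS ▸ mem_image_of_mem Prod.fst hz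
  have hfst' : ∀ z ∈ S, z.1 ∈ Icc a b := fun z hz => Ioo_subset_Icc_self (hfst z hz)
  obtain ⟨ρ, ρ', hρ, hρ', hρ'c, hlog, hAρ, hρi⟩ := exists_logConcave_weight hSo
    (Metric.isOpen_thickening (δ := δ) (E := S)) (hSc.thickening δ) hSb.thickening
    (η := δ / 4) (by linarith)
    (by
      intro t y s hty hs
      refine Metric.mem_thickening_iff.2 ⟨(t, y), hty, ?_⟩
      rw [Prod.dist_eq, dist_self, Real.dist_eq]
      refine max_lt ?_ hδ
      simp only [add_sub_cancel_left]
      linarith) hab hS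
  -- integrability of the functions involved
  have hvc : ContinuousOn v (Icc a b) := fun t ht => (hv t ht).continuousAt.continuousWithinAt
  obtain ⟨N, hN⟩ := isCompact_Icc.exists_bound_of_continuousOn hvc
  set φ : ℝ × (Fin m → ℝ) → ℝ := fun z => |w z| ^ (p - 2) * w z with hφ
  have hφc : ContinuousOn φ S := (continuous_abs_rpow_mul_self hp2).comp_continuousOn hw
  have hφM : ∀ z ∈ S, |φ z| ≤ M ^ (p - 1) := fun z hz => by
    rw [hφ, abs_abs_rpow_mul_self hp2]
    exact Real.rpow_le_rpow (abs_nonneg _) (hM z hz) (by linarith)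
  have hφi : IntegrableOn φ S := hSb.integrableOn_of_norm_le hSo hφc hφM
  have hv1c : ContinuousOn (fun z : ℝ × (Fin m → ℝ) => v z.1) S :=
    hvc.comp continuous_fst.continuousOn hfst'
  have hφvi : IntegrableOn (fun z => φ z * v z.1) S := by
    refine hSb.integrableOn_of_norm_le (M := M ^ (p - 1) * N) hSo (hφc.mul hv1c) fun z hz => ?_
    rw [abs_mul]
    exact mul_le_mul (hφM z hz) (hN _ (hfst' z hz)) (abs_nonneg _) (by positivity)
  have hwpi : IntegrableOn (fun z => |w z| ^ p) S := by
    refine hSb.integrableOn_of_norm_le (M := M ^ p) hSo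
      (hw.abs.rpow_const fun _ _ => Or.inr hp0.le) fun z hz => ?_
    rw [abs_of_nonneg (by positivity)]
    exact Real.rpow_le_rpow (abs_nonneg _) (hM z hz) hp0.le
  have hv'pi : IntegrableOn (fun z : ℝ × (Fin m → ℝ) => |v' z.1| ^ p) S := by
    refine hSb.integrableOn_of_norm_le (M := M') hSo
      ((hv'.comp continuous_fst.continuousOn hfst').abs.rpow_const fun _ _ => Or.inr hp0.le)
      fun z hz => ?_
    rw [abs_of_nonneg (by positivity)]
    exact hM' _ (hfst' z hz)
  have h1i : IntegrableOn (fun _ : ℝ × (Fin m → ℝ) => (1 : ℝ)) S := integrableOn_const hSfin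
  have hci : ∀ c : ℝ, Integrable (fun _ : ℝ × (Fin m → ℝ) => c) (volume.restrict S) := fun c =>
    integrableOn_const hSfin
  set X := ∫ z in S, |w z| ^ p with hX
  set g := sliceIntegral S φ with hg
  have hgi : Integrable g := integrable_sliceIntegral hSo.measurableSet hφi
  have hgc : ContinuousOn g (Ioo a b) := hS ▸ continuousOn_sliceIntegral hSo hSc hSb hφc hφM
  have hg0 : ∫ t in a..b, g t = 0 := by
    rw [← setIntegral_eq_intervalIntegral_sliceIntegral hSo hφi hab hS]
    exact hw0
  -- bound on g
  have hgN : ∀ t, |g t| ≤ M ^ (p - 1) * volume.real (Prod.snd '' S) := by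
    intro t
    rw [hg, sliceIntegral_eq_setIntegral hSo]
    have hTb := hSb.slice t
    have h1 := norm_setIntegral_le_of_norm_le_const (μ := volume) (s := Prod.mk t ⁻¹' S)
      (f := fun y => φ (t, y)) (C := M ^ (p - 1)) hTb.measure_lt_top fun y hy => hφM _ hy
    refine h1.trans (mul_le_mul_of_nonneg_left ?_ (by positivity))
    exact measureReal_mono (fun y hy => ⟨(t, y), hy, rfl⟩) hSb.image_snd.measure_lt_top.ne
  have key := integral_mul_le_of_weight hpq hab hC hlen hρ hρ' hρ'c hlog hgc hgi hgN hg0 hv hv'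
  have hleft : X ≤ M ^ (p - 1) * ε * volume.real S + ∫ t in a..b, g t * v t := by
    have e1 : ∫ t in a..b, g t * v t = ∫ z in S, φ z * v z.1 := by
      rw [setIntegral_eq_intervalIntegral_sliceIntegral hSo hφvi hab hS]
      refine intervalIntegral.integral_congr fun t _ => ?_
      rw [hg, sliceIntegral_eq_setIntegral hSo, sliceIntegral_eq_setIntegral hSo,
        ← integral_mul_const]
    have e2 : ∫ z in S, (M ^ (p - 1) * ε + φ z * v z.1) =
        M ^ (p - 1) * ε * volume.real S + ∫ z in S, φ z * v z.1 := by
      rw [integral_add (hci _) hφvi, setIntegral_const, smul_eq_mul, mul_comm]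
    rw [e1, ← e2]
    refine setIntegral_mono_on hwpi ((hci _).add hφvi) hSo.measurableSet
      fun z hz => ?_
    have h1 : |w z| ^ p = φ z * (w z - v z.1) + φ z * v z.1 := by
      rw [← abs_rpow_mul_self_mul_self hp2]; ring
    rw [h1]
    have h2 : φ z * (w z - v z.1) ≤ M ^ (p - 1) * ε := by
      refine (le_abs_self _).trans ?_
      rw [abs_mul]
      exact mul_le_mul (hφM z hz) (hε z hz) (abs_nonneg _) (by positivity)
    linarith
  -- the dual term
  have hρc : ContinuousOn ρ (Icc a b) := fun t ht => (hρ' t ht).continuousAt.continuousWithinAt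
  have hXs : X = ∫ t in a..b, sliceIntegral S (fun z => |w z| ^ p) t :=
    setIntegral_eq_intervalIntegral_sliceIntegral hSo hwpi hab hS
  have huIcc : uIcc a b = Icc a b := uIcc_of_le hab.le
  have hdual : ∫ t in a..b, ρ t ^ (1 - q) * |g t| ^ q ≤ X := by
    rw [hXs]
    refine intervalIntegral.integral_mono_on_of_le_Ioo hab.le ?_
      (integrable_sliceIntegral hSo.measurableSet hwpi).intervalIntegrable fun t ht => ?_
    · rw [intervalIntegrable_iff_integrableOn_Icc_of_le hab.le]
      have h1 : IntegrableOn (fun t => |g t| ^ q) (Icc a b) := by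
        refine Integrable.of_bound
          ((hgi.aestronglyMeasurable.aemeasurable.abs.pow_const q).aestronglyMeasurable.restrict)
          ((M ^ (p - 1) * volume.real (Prod.snd '' S)) ^ q) (Eventually.of_forall fun t => ?_)
        rw [Real.norm_of_nonneg (by positivity)]
        exact Real.rpow_le_rpow (abs_nonneg _) (hgN t) hq0.le
      exact h1.continuousOn_mul
        (hρc.rpow_const fun t ht => Or.inl (hρ t ht).ne') isCompact_Icc
    · have h1 := abs_sliceIntegral_rpow_le hpq hp2 hSo hSb hw hM t
      have hρt := hρ t (Ioo_subset_Icc_self ht)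
      have hXt : 0 ≤ sliceIntegral S (fun z => |w z| ^ p) t :=
        integral_nonneg fun y => indicator_nonneg (fun z _ => by positivity) _
      have hA0 : 0 ≤ sliceIntegral S (fun _ => 1) t := sliceIntegral_one_nonneg t
      calc ρ t ^ (1 - q) * |g t| ^ q
          ≤ ρ t ^ (1 - q) * (sliceIntegral S (fun z => |w z| ^ p) t * ρ t ^ (q - 1)) := by
            refine mul_le_mul_of_nonneg_left (h1.trans ?_) (Real.rpow_nonneg hρt.le _)
            exact mul_le_mul_of_nonneg_left
              (Real.rpow_le_rpow hA0 (hAρ t ht) (by linarith)) hXt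
        _ = sliceIntegral S (fun z => |w z| ^ p) t * (ρ t ^ (1 - q) * ρ t ^ (q - 1)) := by ring
        _ = sliceIntegral S (fun z => |w z| ^ p) t := by
            rw [← Real.rpow_add hρt]; simp
  -- the energy term
  have hA1 : ∫ t in a..b, sliceIntegral S (fun _ => 1) t = volume.real S := by
    rw [← setIntegral_eq_intervalIntegral_sliceIntegral hSo h1i hab hS]
    simp
  have hAi : IntervalIntegrable (sliceIntegral S (fun _ => 1)) volume a b :=
    (integrable_sliceIntegral hSo.measurableSet h1i).intervalIntegrable
  have hρii : IntervalIntegrable ρ volume a b := (huIcc ▸ hρc).intervalIntegrable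
  have henergy : ∫ t in a..b, ρ t * |v' t| ^ p ≤ (∫ z in S, G z) + ε' * volume.real S +
        M' * (volume.real (Metric.thickening δ S) - volume.real S) := by
    have hM'0 : 0 ≤ M' := (Real.rpow_nonneg (abs_nonneg _) _).trans (hM' a (left_mem_Icc.2 hab.le))
    have h1 : ∫ t in a..b, ρ t * |v' t| ^ p ≤ ∫ t in a..b,
        (sliceIntegral S (fun z => |v' z.1| ^ p) t +
          M' * (ρ t - sliceIntegral S (fun _ => 1) t)) := by
      refine intervalIntegral.integral_mono_on_of_le_Ioo hab.le ?_ ?_ fun t ht => ?_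
      · exact (huIcc ▸ (hρc.mul (hv'.abs.rpow_const fun _ _ => Or.inr hp0.le)) :
          ContinuousOn (fun t => ρ t * |v' t| ^ p) (uIcc a b)).intervalIntegrable
      · exact (integrable_sliceIntegral hSo.measurableSet hv'pi).intervalIntegrable.add
          ((hρii.sub hAi).const_mul _)
      · have e : sliceIntegral S (fun z => |v' z.1| ^ p) t =
            sliceIntegral S (fun _ => 1) t * |v' t| ^ p := by
          rw [sliceIntegral_eq_setIntegral hSo, sliceIntegral_eq_setIntegral hSo,
            ← integral_mul_const]
          simp
        rw [e]
        have h2 := hAρ t ht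
        have h3 := hM' t (Ioo_subset_Icc_self ht)
        nlinarith
    rw [intervalIntegral.integral_add
      (integrable_sliceIntegral hSo.measurableSet hv'pi).intervalIntegrable
      ((hρii.sub hAi).const_mul _), intervalIntegral.integral_const_mul,
      intervalIntegral.integral_sub hρii hAi, hA1,
      ← setIntegral_eq_intervalIntegral_sliceIntegral hSo hv'pi hab hS] at h1
    have h2 : ∫ z in S, |v' z.1| ^ p ≤ (∫ z in S, G z) + ε' * volume.real S := by
      have e : ∫ z in S, (G z + ε') = (∫ z in S, G z) + ε' * volume.real S := by
        rw [integral_add hG (hci _), setIntegral_const, smul_eq_mul,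
          mul_comm ε']
      rw [← e]
      exact setIntegral_mono_on hv'pi (hG.add (hci _)) hSo.measurableSet hGε
    have h3 := mul_le_mul_of_nonneg_left hρi hM'0
    linarith
  -- conclusion
  have hpq1 : 1 / q = 1 - 1 / p := by
    have := hpq.inv_add_inv_eq_one
    simp only [one_div]; linarith
  have h1 : X ≤ M ^ (p - 1) * ε * volume.real S +
      (C ^ p / p * (∫ t in a..b, ρ t * |v' t| ^ p) + (1 - 1 / p) * X) := by
    rw [← hpq1]
    refine hleft.trans (add_le_add le_rfl (key.trans (add_le_add le_rfl ?_)))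
    exact mul_le_mul_of_nonneg_left hdual (by positivity)
  have h2 : X / p ≤ M ^ (p - 1) * ε * volume.real S +
      C ^ p / p * (∫ t in a..b, ρ t * |v' t| ^ p) := by
    have e : X / p = 1 / p * X := by ring
    rw [e]; linarith
  have h3 : C ^ p / p * (∫ t in a..b, ρ t * |v' t| ^ p) ≤ C ^ p / p * _ :=
    mul_le_mul_of_nonneg_left henergy (by positivity)
  have h4 := h2.trans (add_le_add le_rfl h3)
  rw [div_le_iff₀ hp0] at h4
  refine h4.trans (le_of_eq ?_)
  field_simp

theorem integral_abs_rpow_le_of_close_to_fst {p q C : ℝ} (hpq : p.HolderConjugate q) (hp2 : 2 ≤ p)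
    (hC : 0 < C) (hSo : IsOpen S) (hSc : Convex ℝ S) (hSb : Bornology.IsBounded S)
    {a b : ℝ} (hab : a < b) (hS : Prod.fst '' S = Ioo a b) (hlen : b - a < C * pi_p p)
    {w : ℝ × (Fin m → ℝ) → ℝ} (hw : ContinuousOn w S) {M : ℝ} (hM : ∀ z ∈ S, |w z| ≤ M)
    (hw0 : ∫ z in S, |w z| ^ (p - 2) * w z = 0) {v v' : ℝ → ℝ}
    (hv : ∀ t ∈ Icc a b, HasDerivAt v (v' t) t) (hv' : ContinuousOn v' (Icc a b))
    {ε ε' : ℝ} (hε : ∀ z ∈ S, |w z - v z.1| ≤ ε) {G : ℝ × (Fin m → ℝ) → ℝ}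
    (hG : IntegrableOn G S) (hGε : ∀ z ∈ S, |v' z.1| ^ p ≤ G z + ε') :
    ∫ z in S, |w z| ^ p ≤ p * (M ^ (p - 1) * ε * volume.real S) +
      C ^ p * ((∫ z in S, G z) + ε' * volume.real S) := by
  obtain ⟨M', hM'⟩ := isCompact_Icc.exists_bound_of_continuousOn
    (f := fun t => |v' t| ^ p) (hv'.abs.rpow_const fun _ _ => Or.inr (by linarith))
  have hfr : volume (closure S) = volume S := by
    have : (volume : Measure (ℝ × (Fin m → ℝ))).IsAddHaarMeasure :=
      Measure.prod.instIsAddHaarMeasure volume volume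
    refine le_antisymm ?_ (measure_mono subset_closure)
    have h1 : closure S ⊆ S ∪ frontier S := by
      rw [closure_eq_self_union_frontier]
    calc volume (closure S) ≤ volume S + volume (frontier S) :=
          (measure_mono h1).trans (measure_union_le _ _)
      _ = volume S := by rw [hSc.addHaar_frontier volume, add_zero]
  have hlim : Tendsto (fun δ => volume.real (Metric.thickening δ S)) (𝓝[>] 0)
      (𝓝 (volume.real S)) := by
    have h1 := tendsto_measure_thickening (μ := volume) (s := S)
      ⟨1, one_pos, (hSb.thickening (δ := 1)).measure_lt_top.ne⟩
    rw [hfr] at h1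
    exact (ENNReal.tendsto_toReal hSb.measure_lt_top.ne).comp h1
  have hlim2 : Tendsto (fun δ => p * (M ^ (p - 1) * ε * volume.real S) +
      C ^ p * ((∫ z in S, G z) + ε' * volume.real S +
        M' * (volume.real (Metric.thickening δ S) - volume.real S))) (𝓝[>] 0)
      (𝓝 (p * (M ^ (p - 1) * ε * volume.real S) +
      C ^ p * ((∫ z in S, G z) + ε' * volume.real S +
        M' * (volume.real S - volume.real S)))) :=
    tendsto_const_nhds.add ((tendsto_const_nhds.add
      ((hlim.sub tendsto_const_nhds).const_mul _)).const_mul _)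
  rw [sub_self, mul_zero, add_zero] at hlim2
  refine ge_of_tendsto hlim2 ?_
  filter_upwards [self_mem_nhdsWithin] with δ hδ
  exact integral_abs_rpow_le_of_thickening hpq hp2 hC hSo hSc hSb hab hS hlen hw hM hw0 hv hv'
    (fun t ht => (le_abs_self _).trans (hM' t ht)) hε hG hGε hδ

end Thin

lemma exists_continuousLinearEquiv_fst_eq_inner {m : ℕ} (e : EuclideanSpace ℝ (Fin (m + 1)))
    (he : ‖e‖ = 1) :
    ∃ Ψ : (ℝ × (Fin m → ℝ)) ≃L[ℝ] EuclideanSpace ℝ (Fin (m + 1)),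
      MeasurePreserving Ψ ∧ ∀ y, inner ℝ e (Ψ y) = y.1 := by
  have hon : Orthonormal ℝ (Set.domRestrict {0} fun _ : Fin (m + 1) => e) :=
    ⟨fun _ => he, fun i j hij => absurd (Subsingleton.elim i j) hij⟩
  obtain ⟨B, hB⟩ := hon.exists_orthonormalBasis_extension_of_card_eq (by simp)
  have hB0 : B 0 = e := hB 0 rfl
  set Ψ : (ℝ × (Fin m → ℝ)) ≃L[ℝ] EuclideanSpace ℝ (Fin (m + 1)) :=
    ((Fin.consEquivL ℝ fun _ : Fin (m + 1) => ℝ).trans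
      (EuclideanSpace.equiv (Fin (m + 1)) ℝ).symm).trans
        B.repr.symm.toContinuousLinearEquiv with hΨ
  refine ⟨Ψ, ?_, fun y => ?_⟩
  · have h1 := (volume_preserving_piFinSuccAbove (fun _ : Fin (m + 1) => ℝ) 0).symm
    have h2 := (B.measurePreserving_repr_symm.comp
      (PiLp.volume_preserving_toLp (Fin (m + 1)))).comp h1
    have hfun : ⇑Ψ = (⇑B.repr.symm ∘ WithLp.toLp 2) ∘
        ⇑(MeasurableEquiv.piFinSuccAbove (fun _ : Fin (m + 1) => ℝ) 0).symm := by
      funext y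
      simp [hΨ]
      rfl
    rw [hfun]
    exact h2
  · rw [← hB0, ← B.repr_apply_apply]
    simp [hΨ, Fin.consEquivL]

lemma gradient_norm_eq {F : Type*} [NormedAddCommGroup F] [InnerProductSpace ℝ F] [CompleteSpace F]
    (u : F → ℝ) (x : F) : ‖gradient u x‖ = ‖fderiv ℝ u x‖ := by
  rw [gradient, LinearIsometryEquiv.norm_map]

theorem exists_forall_close_to_line_integral_le {m : ℕ} {p q C : ℝ} (hpq : p.HolderConjugate q)
    (hp2 : 2 ≤ p) (hC : 0 < C) {Ω U : Set (EuclideanSpace ℝ (Fin (m + 1)))}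
    (hΩ : Bornology.IsBounded Ω) (hU : IsOpen U) (hΩU : closure Ω ⊆ U)
    {u : EuclideanSpace ℝ (Fin (m + 1)) → ℝ} (hu : ContDiffOn ℝ 1 u U)
    (hdiam : Metric.diam Ω < C * pi_p p) {ε₀ : ℝ} (hε₀ : 0 < ε₀) :
    ∃ δ > 0, ∀ K ⊆ Ω, IsOpen K → Convex ℝ K →
      (∃ x e : EuclideanSpace ℝ (Fin (m + 1)), ‖e‖ = 1 ∧
        ∀ z ∈ K, ‖(z - x) - (inner ℝ e (z - x) : ℝ) • e‖ ≤ δ) →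
      ∫ x in K, |u x| ^ (p - 2) * u x = 0 →
      ∫ x in K, |u x| ^ p ≤ C ^ p * (∫ x in K, ‖fderiv ℝ u x‖ ^ p) + ε₀ * volume.real K := by
  have hp0 : 0 < p := by linarith
  have hcomp : IsCompact (closure Ω) := hΩ.isCompact_closure
  obtain ⟨r, hr, hrU⟩ := hcomp.exists_cthickening_subset_open hU hΩU
  set Q := Metric.cthickening r (closure Ω) with hQ
  have hQc : IsCompact Q := hcomp.cthickening
  have hΩQ : Ω ⊆ Q := subset_closure.trans (Metric.self_subset_cthickening _)
  have huc : ContinuousOn u U := hu.continuousOn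
  have hfc : ContinuousOn (fderiv ℝ u) U := hu.continuousOn_fderiv_of_isOpen hU le_rfl
  have hGc : ContinuousOn (fun x => ‖fderiv ℝ u x‖ ^ p) U :=
    hfc.norm.rpow_const fun _ _ => Or.inr hp0.le
  have hud : ∀ x ∈ U, DifferentiableAt ℝ u x := fun x hx =>
    (hu.differentiableOn one_ne_zero).differentiableAt (hU.mem_nhds hx)
  obtain ⟨M, hM⟩ := hQc.exists_bound_of_continuousOn (huc.mono hrU)
  obtain ⟨N, hN⟩ := hQc.exists_bound_of_continuousOn (hGc.mono hrU)
  set M₁ := |M| with hM₁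
  have hM₁0 : 0 ≤ M₁ := abs_nonneg _
  have hMQ : ∀ x ∈ Q, |u x| ≤ M₁ := fun x hx => (hM x hx).trans (le_abs_self _)
  have hden : 0 < p * M₁ ^ (p - 1) + C ^ p := by positivity
  set ε := ε₀ / (p * M₁ ^ (p - 1) + C ^ p) with hε
  have hε0 : 0 < ε := div_pos hε₀ hden
  obtain ⟨δ₁, hδ₁, hu1⟩ := Metric.uniformContinuousOn_iff.1
    (hQc.uniformContinuousOn_of_continuous (huc.mono hrU)) ε hε0
  obtain ⟨δ₂, hδ₂, hu2⟩ := Metric.uniformContinuousOn_iff.1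
    (hQc.uniformContinuousOn_of_continuous (hGc.mono hrU)) ε hε0
  have hδpos : 0 < min r (min δ₁ δ₂) / 2 := by positivity
  refine ⟨min r (min δ₁ δ₂) / 2, hδpos, ?_⟩
  set δ := min r (min δ₁ δ₂) / 2 with hδ
  have hδr : δ ≤ r := by
    have := min_le_left r (min δ₁ δ₂)
    linarith
  have hδ1 : δ < δ₁ := by
    have := (min_le_right r (min δ₁ δ₂)).trans (min_le_left _ _)
    linarith
  have hδ2 : δ < δ₂ := by
    have := (min_le_right r (min δ₁ δ₂)).trans (min_le_right _ _)
    linarith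
  rintro K hKΩ hKo hKc ⟨x, e, he, hthin⟩ hK0
  rcases K.eq_empty_or_nonempty with rfl | hKne
  · simp
  obtain ⟨Ψ, hΨm, hΨe⟩ := exists_continuousLinearEquiv_fst_eq_inner e he
  have hΨemb : MeasurableEmbedding Ψ := Ψ.toHomeomorph.measurableEmbedding
  have hint : ∀ f : EuclideanSpace ℝ (Fin (m + 1)) → ℝ,
      ∫ z in Ψ ⁻¹' K, f (Ψ z) = ∫ z in K, f z := fun f =>
    hΨm.setIntegral_preimage_emb hΨemb f K
  set S := Ψ ⁻¹' K with hS
  have hSo : IsOpen S := hKo.preimage Ψ.continuous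
  have hSc : Convex ℝ S := hKc.linear_preimage (Ψ : (ℝ × (Fin m → ℝ)) →ₗ[ℝ] _)
  have hSb : Bornology.IsBounded S := by
    have h1 : Bornology.IsBounded (Ψ.symm '' K) :=
      ((hΩ.subset hKΩ).isCompact_closure.image Ψ.symm.continuous).isBounded.subset
        (image_mono subset_closure)
    refine h1.subset fun z hz => ⟨Ψ z, hz, by simp⟩
  have hSne : S.Nonempty := by
    obtain ⟨z, hz⟩ := hKne
    exact ⟨Ψ.symm z, by simpa [hS] using hz⟩
  have hvol : volume.real S = volume.real K := by
    rw [measureReal_def, measureReal_def, hΨm.measure_preimage hKo.measurableSet.nullMeasurableSet]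
  obtain ⟨a, b, hab, hSab⟩ := exists_image_fst_eq_Ioo hSo hSc hSb hSne
  have hba : b - a ≤ Metric.diam Ω := by
    rw [← Real.diam_Ioo hab.le, ← hSab]
    refine Metric.diam_le_of_forall_dist_le Metric.diam_nonneg ?_
    rintro _ ⟨y, hy, rfl⟩ _ ⟨z, hz, rfl⟩
    rw [Real.dist_eq, ← hΨe, ← hΨe, ← inner_sub_right]
    calc |inner ℝ e (Ψ y - Ψ z)| ≤ ‖e‖ * ‖Ψ y - Ψ z‖ := abs_real_inner_le_norm _ _
      _ = dist (Ψ y) (Ψ z) := by rw [he, one_mul, dist_eq_norm]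
      _ ≤ Metric.diam Ω := Metric.dist_le_diam_of_mem hΩ (hKΩ hy) (hKΩ hz)
  set ℓ : ℝ → EuclideanSpace ℝ (Fin (m + 1)) := fun t => x + (t - inner ℝ e x) • e with hℓ
  have hℓc : Continuous ℓ := by fun_prop
  have hℓd : ∀ t, HasDerivAt ℓ e t := fun t => by
    have := (((hasDerivAt_id t).sub_const (inner ℝ e x : ℝ)).smul_const e).const_add x
    rwa [one_smul] at this
  have hdist : ∀ z ∈ S, dist (Ψ z) (ℓ z.1) ≤ δ := by
    intro z hz
    rw [dist_eq_norm]
    have h1 := hthin (Ψ z) hz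
    rw [inner_sub_right, hΨe] at h1
    rwa [hℓ, ← sub_sub]
  have hℓQ : ∀ t ∈ Icc a b, ℓ t ∈ Q := by
    have hsub : Ioo a b ⊆ ℓ ⁻¹' Q := by
      rw [← hSab]
      rintro _ ⟨z, hz, rfl⟩
      refine Metric.mem_cthickening_of_dist_le _ (Ψ z) _ _ (subset_closure (hKΩ hz)) ?_
      rw [dist_comm]
      exact (hdist z hz).trans hδr
    have := closure_minimal hsub (Metric.isClosed_cthickening.preimage hℓc)
    rwa [closure_Ioo hab.ne] at this
  have hSQ : ∀ z ∈ S, Ψ z ∈ Q := fun z hz => hΩQ (hKΩ hz)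
  have hSI : ∀ z ∈ S, z.1 ∈ Icc a b := fun z hz =>
    Ioo_subset_Icc_self (hSab ▸ mem_image_of_mem Prod.fst hz)
  have hGi : IntegrableOn (fun z => ‖fderiv ℝ u (Ψ z)‖ ^ p) S :=
    hSb.integrableOn_of_norm_le (M := N) hSo
      (hGc.comp Ψ.continuous.continuousOn fun z hz => hrU (hSQ z hz))
      fun z hz => hN _ (hSQ z hz)
  have key := integral_abs_rpow_le_of_close_to_fst hpq hp2 hC hSo hSc hSb hab hSab
    (hba.trans_lt hdiam) (w := fun z => u (Ψ z)) (M := M₁)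
    (huc.comp Ψ.continuous.continuousOn fun z hz => hrU (hSQ z hz))
    (fun z hz => hMQ _ (hSQ z hz))
    ((hint fun x => |u x| ^ (p - 2) * u x).trans hK0)
    (v := fun t => u (ℓ t)) (v' := fun t => fderiv ℝ u (ℓ t) e)
    (fun t ht => (hud _ (hrU (hℓQ t ht))).hasFDerivAt.comp_hasDerivAt t (hℓd t))
    ((hfc.comp hℓc.continuousOn fun t ht => hrU (hℓQ t ht)).clm_apply continuousOn_const)
    (ε := ε) (ε' := ε) (G := fun z => ‖fderiv ℝ u (Ψ z)‖ ^ p)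
    (fun z hz => (hu1 _ (hSQ z hz) _ (hℓQ _ (hSI z hz))
      ((hdist z hz).trans_lt hδ1)).le) hGi
    (fun z hz => by
      have h1 := (hu2 _ (hSQ z hz) _ (hℓQ _ (hSI z hz)) ((hdist z hz).trans_lt hδ2)).le
      rw [Real.dist_eq] at h1
      have h2 := (abs_le.1 h1).1
      have h3 : |fderiv ℝ u (ℓ z.1) e| ^ p ≤ ‖fderiv ℝ u (ℓ z.1)‖ ^ p := by
        refine Real.rpow_le_rpow (abs_nonneg _) ?_ hp0.le
        have := (fderiv ℝ u (ℓ z.1)).le_opNorm e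
        rwa [he, mul_one] at this
      linarith)
  rw [hint fun x => |u x| ^ p, hint fun x => ‖fderiv ℝ u x‖ ^ p, hvol] at key
  refine key.trans (le_of_eq ?_)
  have : ε₀ = ε * (p * M₁ ^ (p - 1) + C ^ p) := (div_mul_cancel₀ _ hden.ne').symm
  rw [this]
  ring

section Geometry

variable {V : Type*} [NormedAddCommGroup V] [InnerProductSpace ℝ V]

/-- The Gram determinant of two vectors. -/
noncomputable def gramDet (a b : V) : ℝ :=
  (inner ℝ a a : ℝ) * inner ℝ b b - inner ℝ a b * inner ℝ a b

/-- The affine subspace through `c` orthogonal to `a` and `b`, encoded by the triple `(c, a, b)`. -/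
def orthogonalThrough (j : V × V × V) : Set V :=
  {v | inner ℝ j.2.1 (v - j.1) = 0 ∧ inner ℝ j.2.2 (v - j.1) = 0}

lemma cos_smul_add_sin_smul_ne_zero {a b : V} (h : 0 < gramDet a b) (θ : ℝ) :
    Real.cos θ • a + Real.sin θ • b ≠ 0 := by
  intro h0
  have h1 : inner ℝ a (Real.cos θ • a + Real.sin θ • b) = (0 : ℝ) := by rw [h0, inner_zero_right]
  have h2 : inner ℝ b (Real.cos θ • a + Real.sin θ • b) = (0 : ℝ) := by rw [h0, inner_zero_right]
  rw [inner_add_right, inner_smul_right, inner_smul_right] at h1 h2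
  rw [real_inner_comm a b] at h2
  unfold gramDet at h
  have h3 : Real.cos θ * ((inner ℝ a a : ℝ) * inner ℝ b b - inner ℝ a b * inner ℝ a b) = 0 := by
    linear_combination (inner ℝ b b : ℝ) * h1 - (inner ℝ a b : ℝ) * h2
  have h4 : Real.sin θ * ((inner ℝ a a : ℝ) * inner ℝ b b - inner ℝ a b * inner ℝ a b) = 0 := by
    linear_combination (inner ℝ a a : ℝ) * h2 - (inner ℝ a b : ℝ) * h1
  have h5 := (mul_eq_zero.1 h3).resolve_right h.ne'
  have h6 := (mul_eq_zero.1 h4).resolve_right h.ne'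
  have := Real.sin_sq_add_cos_sq θ
  rw [h5, h6] at this
  norm_num at this

lemma exists_close_to_line_of_gramDet_le [Nontrivial V] {K : Set V} {δ : ℝ} (hδ : 0 < δ)
    (hK : ∀ x ∈ K, ∀ y ∈ K, ∀ z ∈ K, gramDet (y - x) (z - x) ≤ δ ^ 4) :
    ∃ x e : V, ‖e‖ = 1 ∧ ∀ z ∈ K, ‖(z - x) - (inner ℝ e (z - x) : ℝ) • e‖ ≤ δ := by
  have hsq : ∀ e w : V, ‖e‖ = 1 → ‖w - (inner ℝ e w : ℝ) • e‖ ^ 2 =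
      inner ℝ w w - inner ℝ e w * inner ℝ e w := by
    intro e w he
    rw [← real_inner_self_eq_norm_sq, inner_sub_left, inner_sub_right, inner_sub_right,
      inner_smul_left, inner_smul_right, inner_smul_left, inner_smul_right,
      real_inner_self_eq_norm_sq e, he, real_inner_comm e w]
    simp
  by_cases h : ∃ x ∈ K, ∃ y ∈ K, δ < ‖y - x‖
  · obtain ⟨x, hx, y, hy, hxy⟩ := h
    have hpos : 0 < ‖y - x‖ := hδ.trans hxy
    have he : ‖‖y - x‖⁻¹ • (y - x)‖ = 1 := by
      rw [norm_smul, norm_inv, norm_norm, inv_mul_cancel₀ hpos.ne']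
    refine ⟨x, ‖y - x‖⁻¹ • (y - x), he, fun z hz => ?_⟩
    refine le_of_sq_le_sq ?_ hδ.le
    rw [hsq _ _ he]
    have h1 := hK x hx y hy z hz
    unfold gramDet at h1
    rw [real_inner_self_eq_norm_sq (y - x)] at h1
    rw [inner_smul_left]
    simp only [conj_trivial]
    have h2 : (inner ℝ (z - x) (z - x) : ℝ) - ‖y - x‖⁻¹ * inner ℝ (y - x) (z - x) *
        (‖y - x‖⁻¹ * inner ℝ (y - x) (z - x)) = (‖y - x‖ ^ 2 * inner ℝ (z - x) (z - x) -
          inner ℝ (y - x) (z - x) * inner ℝ (y - x) (z - x)) / ‖y - x‖ ^ 2 := by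
      field_simp
    rw [h2, div_le_iff₀ (by positivity)]
    have h3 : δ ^ 2 ≤ ‖y - x‖ ^ 2 := pow_le_pow_left₀ hδ.le hxy.le 2
    nlinarith [sq_nonneg δ]
  · push Not at h
    obtain ⟨e, he⟩ := exists_norm_eq V zero_le_one
    rcases K.eq_empty_or_nonempty with rfl | ⟨x, hx⟩
    · exact ⟨0, e, he, by simp⟩
    refine ⟨x, e, he, fun z hz => ?_⟩
    refine le_of_sq_le_sq ?_ hδ.le
    rw [hsq _ _ he, real_inner_self_eq_norm_sq]
    have h1 := pow_le_pow_left₀ (norm_nonneg _) (h x hx z hz) 2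
    nlinarith [mul_self_nonneg (inner ℝ e (z - x) : ℝ)]

lemma eventually_convex_meets_orthogonalThrough {x₀ y₀ z₀ : V}
    (h : 0 < gramDet (y₀ - x₀) (z₀ - x₀)) :
    ∀ᶠ w : V × V × V in 𝓝 (x₀, y₀, z₀), ∀ K : Set V, Convex ℝ K → w.1 ∈ K → w.2.1 ∈ K →
      w.2.2 ∈ K → (K ∩ orthogonalThrough
        ((1 / 3 : ℝ) • (x₀ + y₀ + z₀), y₀ - x₀, z₀ - x₀)).Nonempty := by
  set a := y₀ - x₀ with ha
  set b := z₀ - x₀ with hb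
  set c := (1 / 3 : ℝ) • (x₀ + y₀ + z₀) with hc
  have hcx : c - x₀ = (1 / 3 : ℝ) • (a + b) := by
    rw [hc, ha, hb]; module
  set D : V × V × V → ℝ := fun w => (inner ℝ a (w.2.1 - w.1) : ℝ) * inner ℝ b (w.2.2 - w.1) -
    inner ℝ a (w.2.2 - w.1) * inner ℝ b (w.2.1 - w.1) with hD
  set P : V × V × V → ℝ := fun w => (inner ℝ a (c - w.1) : ℝ) * inner ℝ b (w.2.2 - w.1) -
    inner ℝ a (w.2.2 - w.1) * inner ℝ b (c - w.1) with hP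
  set R : V × V × V → ℝ := fun w => (inner ℝ a (w.2.1 - w.1) : ℝ) * inner ℝ b (c - w.1) -
    inner ℝ a (c - w.1) * inner ℝ b (w.2.1 - w.1) with hR
  have hDc : Continuous D := by fun_prop
  have hPc : Continuous P := by fun_prop
  have hRc : Continuous R := by fun_prop
  have hD0 : D (x₀, y₀, z₀) = gramDet a b := by
    simp only [hD, gramDet, ← ha, ← hb, real_inner_comm a b]
  have hP0 : P (x₀, y₀, z₀) = gramDet a b / 3 := by
    simp only [hP, gramDet, ← hb, hcx, inner_smul_right, inner_add_right,
      real_inner_comm a b]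
    ring
  have hR0 : R (x₀, y₀, z₀) = gramDet a b / 3 := by
    simp only [hR, gramDet, ← ha, hcx, inner_smul_right, inner_add_right,
      real_inner_comm a b]
    ring
  have e1 : ∀ᶠ w in 𝓝 (x₀, y₀, z₀), 0 < P w :=
    hPc.continuousAt.eventually (lt_mem_nhds (by rw [hP0]; positivity))
  have e2 : ∀ᶠ w in 𝓝 (x₀, y₀, z₀), 0 < R w :=
    hRc.continuousAt.eventually (lt_mem_nhds (by rw [hR0]; positivity))
  have e3 : ∀ᶠ w in 𝓝 (x₀, y₀, z₀), 0 < D w - P w - R w :=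
    ((hDc.sub hPc).sub hRc).continuousAt.eventually (lt_mem_nhds (by
      show 0 < D (x₀, y₀, z₀) - P (x₀, y₀, z₀) - R (x₀, y₀, z₀)
      rw [hP0, hR0, hD0]; linarith))
  filter_upwards [e1, e2, e3] with w h1 h2 h3 K hK hx hy hz
  have hDpos : 0 < D w := by linarith
  refine ⟨w.1 + (P w / D w) • (w.2.1 - w.1) + (R w / D w) • (w.2.2 - w.1), ?_, ?_, ?_⟩
  · have hs : 0 ≤ P w / D w := by positivity
    have ht : 0 ≤ R w / D w := by positivity
    have hst : P w / D w + R w / D w < 1 := by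
      rw [← add_div, div_lt_one hDpos]; linarith
    have hcomb := hK.sum_mem (t := Finset.univ)
      (w := ![1 - P w / D w - R w / D w, P w / D w, R w / D w]) (z := ![w.1, w.2.1, w.2.2])
      (by
        intro i _
        fin_cases i
        · show 0 ≤ 1 - P w / D w - R w / D w
          linarith
        · exact hs
        · exact ht)
      (by
        rw [Fin.sum_univ_three]
        show 1 - P w / D w - R w / D w + P w / D w + R w / D w = 1
        ring)
      (by
        intro i _
        fin_cases i
        exacts [hx, hy, hz])
    rw [Fin.sum_univ_three] at hcomb
    change (1 - P w / D w - R w / D w) • w.1 + (P w / D w) • w.2.1 + (R w / D w) • w.2.2 ∈ K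
      at hcomb
    convert hcomb using 1
    module
  · have : w.1 + (P w / D w) • (w.2.1 - w.1) + (R w / D w) • (w.2.2 - w.1) - c =
        (P w / D w) • (w.2.1 - w.1) + (R w / D w) • (w.2.2 - w.1) - (c - w.1) := by abel
    simp only [this, inner_add_right, inner_sub_right _ _ (c - w.1), inner_smul_right]
    field_simp
    simp only [hP, hR, hD]
    ring
  · have : w.1 + (P w / D w) • (w.2.1 - w.1) + (R w / D w) • (w.2.2 - w.1) - c =
        (P w / D w) • (w.2.1 - w.1) + (R w / D w) • (w.2.2 - w.1) - (c - w.1) := by abel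
    simp only [this, inner_add_right, inner_sub_right _ _ (c - w.1), inner_smul_right]
    field_simp
    simp only [hP, hR, hD]
    ring

lemma exists_finset_orthogonalThrough {Q : Set V} (hQ : IsCompact Q) {κ : ℝ} (hκ : 0 < κ) :
    ∃ T : Finset (V × V × V), (∀ j ∈ T, 0 < gramDet j.2.1 j.2.2) ∧
      ∀ K ⊆ Q, Convex ℝ K → (∀ j ∈ T, Disjoint K (orthogonalThrough j)) →
        ∀ x ∈ K, ∀ y ∈ K, ∀ z ∈ K, gramDet (y - x) (z - x) ≤ κ := by
  classical
  set G : V × V × V → ℝ := fun w => gramDet (w.2.1 - w.1) (w.2.2 - w.1) with hG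
  have hGc : Continuous G := by unfold G gramDet; fun_prop
  have hcomp : IsCompact ((Q ×ˢ Q ×ˢ Q) ∩ {w | κ ≤ G w}) :=
    (hQ.prod (hQ.prod hQ)).inter_right (isClosed_le continuous_const hGc)
  set j : V × V × V → V × V × V := fun w =>
    ((1 / 3 : ℝ) • (w.1 + w.2.1 + w.2.2), w.2.1 - w.1, w.2.2 - w.1) with hj
  obtain ⟨T, hT, hcov⟩ := hcomp.elim_nhds_subcover (fun w => {w' : V × V × V | ∀ K : Set V,
    Convex ℝ K → w'.1 ∈ K → w'.2.1 ∈ K → w'.2.2 ∈ K →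
      (K ∩ orthogonalThrough (j w)).Nonempty})
    (fun w hw => eventually_convex_meets_orthogonalThrough (x₀ := w.1) (y₀ := w.2.1)
      (z₀ := w.2.2) (hκ.trans_le hw.2))
  refine ⟨T.image j, ?_, fun K hKQ hK hdisj x hx y hy z hz => ?_⟩
  · intro i hi
    obtain ⟨w, hw, rfl⟩ := Finset.mem_image.1 hi
    exact hκ.trans_le (hT w hw).2
  · by_contra! hlt
    have hmem : (x, y, z) ∈ (Q ×ˢ Q ×ˢ Q) ∩ {w | κ ≤ G w} :=
      ⟨⟨hKQ hx, hKQ hy, hKQ hz⟩, hlt.le⟩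
    obtain ⟨w, hw, hwK⟩ := mem_iUnion₂.1 (hcov hmem)
    obtain ⟨v, hvK, hv⟩ := hwK K hK hx hy hz
    exact (hdisj (j w) (Finset.mem_image_of_mem _ hw)).le_bot ⟨hvK, hv⟩

end Geometry

section Bisection

variable {V : Type*} [NormedAddCommGroup V] [InnerProductSpace ℝ V] [FiniteDimensional ℝ V]
  [MeasurableSpace V] [BorelSpace V] {μ : Measure V} [μ.IsAddHaarMeasure]

lemma addHaar_hyperplane {v : V} (hv : v ≠ 0) (c : V) :
    μ {z | (inner ℝ v (z - c) : ℝ) = 0} = 0 := by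
  have hset : {z | (inner ℝ v (z - c) : ℝ) = 0} =
      (AffineSubspace.mk' c (LinearMap.ker (innerSL ℝ v).toLinearMap) : AffineSubspace ℝ V) := by
    ext z
    simp [AffineSubspace.mem_mk']
  rw [hset]
  refine Measure.addHaar_affineSubspace μ _ fun htop => ?_
  have : v + c ∈ AffineSubspace.mk' c (LinearMap.ker (innerSL ℝ v).toLinearMap) := by
    rw [htop]; trivial
  simp [AffineSubspace.mem_mk'] at this
  exact hv this

/-- Among the half-spaces whose boundary contains `c` and has normal in the plane spanned by `a`
and `b`, one bisects any given zero-mean function. -/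
lemma exists_setIntegral_halfSpace_eq_zero {K : Set V} {g : V → ℝ} (hg : IntegrableOn g K μ)
    (h0 : ∫ z in K, g z ∂μ = 0) {a b : V}
    (hab : ∀ θ : ℝ, Real.cos θ • a + Real.sin θ • b ≠ 0) (c : V) :
    ∃ θ : ℝ,
      ∫ z in K ∩ {z | 0 < (inner ℝ (Real.cos θ • a + Real.sin θ • b) (z - c) : ℝ)}, g z ∂μ = 0 := by
  set N : ℝ → V := fun θ => Real.cos θ • a + Real.sin θ • b with hN
  have hNc : Continuous N := by fun_prop
  set H : ℝ → Set V := fun θ => {z | 0 < (inner ℝ (N θ) (z - c) : ℝ)} with hH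
  have hHm : ∀ θ, MeasurableSet (H θ) := fun θ =>
    (isOpen_lt continuous_const (by fun_prop)).measurableSet
  set J : ℝ → ℝ := fun θ => ∫ z in K, (H θ).indicator g z ∂μ with hJ
  have hJeq : ∀ θ, J θ = ∫ z in K ∩ H θ, g z ∂μ := fun θ => setIntegral_indicator (hHm θ)
  have hae : ∀ θ, ∀ᵐ z ∂(μ.restrict K), (inner ℝ (N θ) (z - c) : ℝ) ≠ 0 := fun θ =>
    ae_restrict_of_ae (measure_eq_zero_iff_ae_notMem.1 (addHaar_hyperplane (hab θ) c))
  have hJc : Continuous J := by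
    refine continuous_iff_continuousAt.2 fun θ => ?_
    refine continuousAt_of_dominated (bound := fun z => ‖g z‖)
      (Eventually.of_forall fun θ' => hg.aestronglyMeasurable.indicator (hHm θ'))
      (Eventually.of_forall fun θ' => Eventually.of_forall fun z => norm_indicator_le_norm_self _ _)
      hg.norm ?_
    filter_upwards [hae θ] with z hz
    have hcont : Continuous fun θ' => (inner ℝ (N θ') (z - c) : ℝ) := by fun_prop
    rcases lt_or_gt_of_ne hz with hlt | hgt
    · have : ∀ᶠ θ' in 𝓝 θ, (H θ').indicator g z = (0 : ℝ) := by
        filter_upwards [hcont.continuousAt.eventually (gt_mem_nhds hlt)] with θ' h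
        exact indicator_of_notMem
          (fun h' : z ∈ H θ' => (show 0 < (inner ℝ (N θ') (z - c) : ℝ) from h').not_gt h) g
      exact (continuousAt_const (y := (0 : ℝ))).congr (this.mono fun _ h => h.symm)
    · have : ∀ᶠ θ' in 𝓝 θ, (H θ').indicator g z = g z := by
        filter_upwards [hcont.continuousAt.eventually (lt_mem_nhds hgt)] with θ' h
        exact indicator_of_mem (show z ∈ H θ' from h) _
      exact (continuousAt_const (y := g z)).congr (this.mono fun _ h => h.symm)
  have hint : ∀ θ, IntegrableOn ((H θ).indicator g) K μ := fun θ => hg.indicator (hHm θ)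
  have hsum : J 0 + J Real.pi = 0 := by
    show ∫ z in K, (H 0).indicator g z ∂μ + ∫ z in K, (H Real.pi).indicator g z ∂μ = 0
    refine (integral_add (hint 0) (hint Real.pi)).symm.trans (Eq.trans ?_ h0)
    refine integral_congr_ae ?_
    filter_upwards [hae 0] with z hz
    simp only [hN, Real.cos_zero, Real.sin_zero, one_smul, zero_smul, add_zero] at hz
    simp only [hH, hN, indicator, mem_ofPred_eq, Real.cos_zero, Real.sin_zero, one_smul, zero_smul,
      add_zero, Real.cos_pi, Real.sin_pi, neg_smul, inner_neg_left]
    rcases lt_or_gt_of_ne hz with hlt | hgt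
    · rw [if_neg hlt.not_gt, if_pos (by linarith), zero_add]
    · rw [if_pos hgt, if_neg (by linarith), add_zero]
  have hivt : ∃ θ, J θ = 0 := by
    have hmem : (0 : ℝ) ∈ uIcc (J 0) (J Real.pi) := by
      rw [mem_uIcc]
      rcases le_total (J 0) 0 with h | h
      · left; constructor <;> linarith
      · right; constructor <;> linarith
    obtain ⟨θ, -, hθ⟩ := intermediate_value_uIcc hJc.continuousOn hmem
    exact ⟨θ, hθ⟩
  obtain ⟨θ, hθ⟩ := hivt
  exact ⟨θ, by rw [← hJeq θ, hθ]⟩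

/-- Splitting an integral along a hyperplane. -/
lemma setIntegral_halfSpaces_add {K : Set V} {f : V → ℝ} (hf : IntegrableOn f K μ) {v : V}
    (hv : v ≠ 0) (c : V) :
    ∫ z in K ∩ {z | 0 < (inner ℝ v (z - c) : ℝ)}, f z ∂μ +
      ∫ z in K ∩ {z | (inner ℝ v (z - c) : ℝ) < 0}, f z ∂μ = ∫ z in K, f z ∂μ := by
  have hm₁ : MeasurableSet {z | 0 < (inner ℝ v (z - c) : ℝ)} :=
    (isOpen_lt continuous_const (by fun_prop)).measurableSet
  have hm₂ : MeasurableSet {z | (inner ℝ v (z - c) : ℝ) < 0} :=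
    (isOpen_lt (by fun_prop) continuous_const).measurableSet
  rw [← setIntegral_indicator hm₁, ← setIntegral_indicator hm₂,
    ← integral_add (hf.indicator hm₁) (hf.indicator hm₂)]
  refine integral_congr_ae ?_
  filter_upwards [ae_restrict_of_ae (measure_eq_zero_iff_ae_notMem.1
    (addHaar_hyperplane (μ := μ) hv c))] with z hz
  simp only [indicator, mem_ofPred_eq]
  rcases lt_or_gt_of_ne (show (inner ℝ v (z - c) : ℝ) ≠ 0 from hz) with hlt | hgt
  · rw [if_neg hlt.not_gt, if_pos hlt, zero_add]
  · rw [if_pos hgt, if_neg hgt.not_gt, add_zero]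

end Bisection

lemma disjoint_halfSpace_orthogonalThrough {V : Type*} [NormedAddCommGroup V]
    [InnerProductSpace ℝ V] {S : Set V} {a b c : V} {s t : ℝ}
    (h : ∀ z ∈ S, (inner ℝ (s • a + t • b) (z - c) : ℝ) ≠ 0) :
    Disjoint S (orthogonalThrough (c, a, b)) := by
  refine disjoint_left.2 fun z hz hz' => h z hz ?_
  obtain ⟨h1, h2⟩ := hz'
  simp only at h1 h2
  rw [inner_add_left, inner_smul_left, inner_smul_left, h1, h2]
  simp

/-- An inequality that is additive in the domain only has to be checked on the pieces of a
decomposition into convex sets on which `g` has mean zero and which avoid finitely many affine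
subspaces of codimension two. -/
lemma integral_le_of_forall_disjoint {V : Type*} [NormedAddCommGroup V] [InnerProductSpace ℝ V]
    [FiniteDimensional ℝ V] [MeasurableSpace V] [BorelSpace V] {μ : Measure V} [μ.IsAddHaarMeasure]
    {Ω : Set V} {g F G : V → ℝ} (hg : IntegrableOn g Ω μ) (hF : IntegrableOn F Ω μ)
    (hG : IntegrableOn G Ω μ) {T : Finset (V × V × V)}
    (hT : ∀ j ∈ T, 0 < gramDet j.2.1 j.2.2)
    (H : ∀ K ⊆ Ω, IsOpen K → Convex ℝ K → ∫ z in K, g z ∂μ = 0 →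
      (∀ j ∈ T, Disjoint K (orthogonalThrough j)) → ∫ z in K, F z ∂μ ≤ ∫ z in K, G z ∂μ)
    {K : Set V} (hKΩ : K ⊆ Ω) (hK : IsOpen K) (hKc : Convex ℝ K) (h0 : ∫ z in K, g z ∂μ = 0) :
    ∫ z in K, F z ∂μ ≤ ∫ z in K, G z ∂μ := by
  classical
  suffices hind : ∀ t : Finset (V × V × V), t ⊆ T → ∀ K ⊆ Ω, IsOpen K → Convex ℝ K →
      ∫ z in K, g z ∂μ = 0 → (∀ j ∈ T, j ∉ t → Disjoint K (orthogonalThrough j)) →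
        ∫ z in K, F z ∂μ ≤ ∫ z in K, G z ∂μ from
    hind T subset_rfl K hKΩ hK hKc h0 fun j hj hj' => absurd hj hj'
  intro t
  induction t using Finset.induction_on with
  | empty =>
    intro _ K hKΩ hK hKc h0 hdisj
    exact H K hKΩ hK hKc h0 fun j hj => hdisj j hj (Finset.notMem_empty j)
  | insert j t _ ih =>
    intro hjt K hKΩ hK hKc h0 hdisj
    obtain ⟨c, a, b⟩ := j
    have hab := cos_smul_add_sin_smul_ne_zero (hT _ (hjt (Finset.mem_insert_self _ _)))
    have htT : t ⊆ T := (Finset.subset_insert _ _).trans hjt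
    obtain ⟨θ, hθ⟩ := exists_setIntegral_halfSpace_eq_zero (hg.mono_set hKΩ) h0 hab c
    have hθ' := setIntegral_halfSpaces_add (hg.mono_set hKΩ) (hab θ) c
    rw [hθ, h0, zero_add] at hθ'
    rw [← setIntegral_halfSpaces_add (hF.mono_set hKΩ) (hab θ) c,
      ← setIntegral_halfSpaces_add (hG.mono_set hKΩ) (hab θ) c]
    set v := Real.cos θ • a + Real.sin θ • b with hv
    have hlin : IsLinearMap ℝ fun z : V => (inner ℝ v z : ℝ) :=
      ⟨fun x y => inner_add_right v x y, fun r x => inner_smul_right v x r⟩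
    have hpos : {z | 0 < (inner ℝ v (z - c) : ℝ)} = {z | (inner ℝ v c : ℝ) < inner ℝ v z} := by
      ext z; simp [inner_sub_right]
    have hneg : {z | (inner ℝ v (z - c) : ℝ) < 0} = {z | (inner ℝ v z : ℝ) < inner ℝ v c} := by
      ext z; simp [inner_sub_right]
    have hdisj' : ∀ S ⊆ K, (∀ z ∈ S, (inner ℝ v (z - c) : ℝ) ≠ 0) →
        ∀ j ∈ T, j ∉ t → Disjoint S (orthogonalThrough j) := by
      intro S hSK hS j hj hjt'
      by_cases hjc : j = (c, a, b)
      · rw [hjc]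
        exact disjoint_halfSpace_orthogonalThrough hS
      · exact (hdisj j hj (by simp [hjc, hjt'])).mono_left hSK
    refine add_le_add ?_ ?_
    · refine ih htT _ (inter_subset_left.trans hKΩ)
        (hK.inter (isOpen_lt continuous_const (by fun_prop))) (hKc.inter ?_) hθ
        (hdisj' _ inter_subset_left fun z hz => (show 0 < (inner ℝ v (z - c) : ℝ) from hz.2).ne')
      rw [hpos]
      exact convex_halfSpace_gt hlin _
    · refine ih htT _ (inter_subset_left.trans hKΩ)
        (hK.inter (isOpen_lt (by fun_prop) continuous_const)) (hKc.inter ?_) hθ'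
        (hdisj' _ inter_subset_left fun z hz => (show (inner ℝ v (z - c) : ℝ) < 0 from hz.2).ne)
      rw [hneg]
      exact convex_halfSpace_lt hlin _

lemma pi_p_pos {p : ℝ} (hp : 2 ≤ p) : 0 < pi_p p := by
  have hs : 0 < Real.sin (Real.pi / p) :=
    Real.sin_pos_of_pos_of_lt_pi (div_pos Real.pi_pos (by linarith))
      (div_lt_self Real.pi_pos (by linarith))
  have h1 : 0 < p - 1 := by linarith
  have := Real.pi_pos
  unfold pi_p
  positivity

lemma integral_abs_rpow_le_of_diam_lt {m : ℕ} {p C : ℝ} (hp : 2 ≤ p) (hC : 0 < C)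
    {Ω U : Set (EuclideanSpace ℝ (Fin (m + 1)))} (hΩo : IsOpen Ω) (hΩc : Convex ℝ Ω)
    (hΩ : Bornology.IsBounded Ω) (hU : IsOpen U) (hΩU : closure Ω ⊆ U)
    {u : EuclideanSpace ℝ (Fin (m + 1)) → ℝ} (hu : ContDiffOn ℝ 1 u U)
    (hmean : ∫ x in Ω, |u x| ^ (p - 2) * u x = 0)
    (hdiam : Metric.diam Ω < C * pi_p p) :
    ∫ x in Ω, |u x| ^ p ≤ C ^ p * ∫ x in Ω, ‖fderiv ℝ u x‖ ^ p := by
  have hcomp : IsCompact (closure Ω) := hΩ.isCompact_closure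
  have huc : ContinuousOn u (closure Ω) := hu.continuousOn.mono hΩU
  have hdc : ContinuousOn (fderiv ℝ u) (closure Ω) :=
    (hu.continuousOn_fderiv_of_isOpen hU le_rfl).mono hΩU
  have hg : IntegrableOn (fun x => |u x| ^ (p - 2) * u x) Ω :=
    (((continuous_abs_rpow_mul_self hp).comp_continuousOn huc).integrableOn_compact hcomp).mono_set
      subset_closure
  have hF : IntegrableOn (fun x => |u x| ^ p) Ω :=
    ((huc.abs.rpow_const fun x _ => Or.inr (by linarith)).integrableOn_compact hcomp).mono_set
      subset_closure
  have hD : IntegrableOn (fun x => ‖fderiv ℝ u x‖ ^ p) Ω :=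
    ((hdc.norm.rpow_const fun x _ => Or.inr (by linarith)).integrableOn_compact hcomp).mono_set
      subset_closure
  have hvol : volume Ω ≠ ⊤ := hΩ.measure_lt_top.ne
  have key : ∀ ε > 0, ∫ x in Ω, |u x| ^ p ≤
      C ^ p * (∫ x in Ω, ‖fderiv ℝ u x‖ ^ p) + ε * volume.real Ω := by
    intro ε hε
    have hG : ∀ K ⊆ Ω, ∫ x in K, (C ^ p * ‖fderiv ℝ u x‖ ^ p + ε) =
        C ^ p * (∫ x in K, ‖fderiv ℝ u x‖ ^ p) + ε * volume.real K := by
      intro K hK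
      rw [integral_add ((hD.mono_set hK).const_mul _)
        (integrableOn_const (measure_ne_top_of_subset hK hvol)), integral_const_mul,
        setIntegral_const, smul_eq_mul, mul_comm (volume.real K)]
    obtain ⟨δ, hδ, hline⟩ := exists_forall_close_to_line_integral_le
      (Real.HolderConjugate.conjExponent (show 1 < p by linarith)) hp hC hΩ hU hΩU hu hdiam hε
    obtain ⟨T, hT, hTK⟩ := exists_finset_orthogonalThrough hcomp (pow_pos hδ 4)
    rw [← hG Ω subset_rfl]
    refine integral_le_of_forall_disjoint hg hF
      ((hD.const_mul _).add (integrableOn_const hvol)) hT ?_ subset_rfl hΩo hΩc hmean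
    intro K hK hKo hKc h0 hdisj
    refine (hline K hK hKo hKc (exists_close_to_line_of_gramDet_le hδ
      (hTK K (hK.trans subset_closure) hKc hdisj)) h0).trans_eq (hG K hK).symm
  have hlim : Tendsto (fun ε : ℝ => C ^ p * (∫ x in Ω, ‖fderiv ℝ u x‖ ^ p) + ε * volume.real Ω)
      (𝓝[>] 0) (𝓝 (C ^ p * (∫ x in Ω, ‖fderiv ℝ u x‖ ^ p) + 0 * volume.real Ω)) :=
    ((continuous_const.add (continuous_id.mul continuous_const)).tendsto 0).mono_left
      nhdsWithin_le_nhds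
  rw [zero_mul, add_zero] at hlim
  exact ge_of_tendsto hlim (eventually_mem_nhdsWithin.mono key)

lemma integral_abs_rpow_le {m : ℕ} {p : ℝ} (hp : 2 ≤ p)
    {Ω U : Set (EuclideanSpace ℝ (Fin (m + 1)))} (hΩo : IsOpen Ω) (hΩc : Convex ℝ Ω)
    (hΩ : Bornology.IsBounded Ω) (hd : 0 < Metric.diam Ω) (hU : IsOpen U) (hΩU : closure Ω ⊆ U)
    {u : EuclideanSpace ℝ (Fin (m + 1)) → ℝ} (hu : ContDiffOn ℝ 1 u U)
    (hmean : ∫ x in Ω, |u x| ^ (p - 2) * u x = 0) :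
    ∫ x in Ω, |u x| ^ p ≤ (Metric.diam Ω / pi_p p) ^ p * ∫ x in Ω, ‖fderiv ℝ u x‖ ^ p := by
  have hpi := pi_p_pos hp
  have hC : 0 < Metric.diam Ω / pi_p p := div_pos hd hpi
  have hlim : Tendsto (fun C : ℝ => C ^ p * ∫ x in Ω, ‖fderiv ℝ u x‖ ^ p)
      (𝓝[>] (Metric.diam Ω / pi_p p))
      (𝓝 ((Metric.diam Ω / pi_p p) ^ p * ∫ x in Ω, ‖fderiv ℝ u x‖ ^ p)) :=
    (((Real.continuousAt_rpow_const _ p (Or.inl hC.ne')).mul continuousAt_const).tendsto).mono_left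
      nhdsWithin_le_nhds
  refine ge_of_tendsto hlim (eventually_mem_nhdsWithin.mono fun C hlt => ?_)
  exact integral_abs_rpow_le_of_diam_lt hp (hC.trans hlt) hΩo hΩc hΩ hU hΩU hu hmean
    ((div_lt_iff₀ hpi).1 hlt)

end Auxiliary

/-- **Main Theorem (Payne–Weinberger type inequality for the p-Laplacian).**
Let `Ω ⊂ ℝⁿ` be a bounded open convex set with diameter `d > 0` and `p ≥ 2`. For every
continuously differentiable function `u` on a neighborhood of the closure of `Ω` with
`∫_Ω |u|^(p-2) u = 0`, one has `∫_Ω ‖∇u‖^p ≥ (π_p/d)^p ∫_Ω |u|^p`. -/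
theorem poincare_convex_pLaplacian
    (n : ℕ) (Ω : Set (EuclideanSpace ℝ (Fin n)))
    (hΩopen : IsOpen Ω) (hΩconv : Convex ℝ Ω) (hΩbdd : Bornology.IsBounded Ω)
    (hd : 0 < Metric.diam Ω)
    (p : ℝ) (hp : 2 ≤ p)
    (u : EuclideanSpace ℝ (Fin n) → ℝ)
    (U : Set (EuclideanSpace ℝ (Fin n))) (hUopen : IsOpen U) (hUnbhd : closure Ω ⊆ U)
    (hu : ContDiffOn ℝ 1 u U)
    (hmean : ∫ x in Ω, |u x| ^ (p - 2) * u x = 0) :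
    ∫ x in Ω, ‖gradient u x‖ ^ p ≥
      (pi_p p / Metric.diam Ω) ^ p * ∫ x in Ω, |u x| ^ p := by
  rcases n with _ | m
  · exact absurd hd (by rw [Metric.diam_subsingleton Set.subsingleton_of_subsingleton]; simp)
  simp only [gradient_norm_eq]
  have h := integral_abs_rpow_le hp hΩopen hΩconv hΩbdd hd hUopen hUnbhd hu hmean
  have hpi := pi_p_pos hp
  rw [ge_iff_le, ← inv_div, Real.inv_rpow (by positivity),
    inv_mul_le_iff₀ (by positivity)]
  exact h
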